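/- arXiv:2210.00949 — 5 statements merged into one kernel-verified Lean document; each statement's English description precedes it below -/
import Mathlib

section
/- Let d ≥ 1, let Ω ⊂ ℝ^d be a compact convex set, let ρ be a Borel probability measure on Ω that is absolutely continuous with respect to Lebesgue measure, let ℱ be a compact topological space, let ℒ : ℱ × P(Ω) → ℝ be jointly continuous and nonnegative, and let τ > 0. Define the functional C(T, F) = ℒ(F, T_♯ρ) + (1/(2τ)) ∫_Ω ‖T(x) − x‖² dρ(x) over all Borel measurable maps T : Ω → Ω and all F ∈ ℱ. Then C attains its infimum at some pair (T*, F*) such that T* is an optimal transport map from ρ to T*_♯ρ. -/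
open MeasureTheory Filter Topology Set

/-- Squared Wasserstein distance between two probability measures on a subset `Ω` of `ℝ^d`:
the infimum over couplings `γ` on `Ω × Ω` with the given marginals of `∫ ‖x - y‖² dγ`. -/
noncomputable def W2sq {d : ℕ} {Ω : Set (EuclideanSpace ℝ (Fin d))}
    (α β : Measure Ω) : ℝ :=
  sInf {c : ℝ | ∃ γ : Measure (Ω × Ω), IsProbabilityMeasure γ ∧
    γ.map Prod.fst = α ∧ γ.map Prod.snd = β ∧
    c = ∫ p, ‖(p.1 : EuclideanSpace ℝ (Fin d)) - (p.2 : EuclideanSpace ℝ (Fin d))‖ ^ 2 ∂γ}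

/-- `T` is an optimal transport map from `α` to `β` (for the quadratic cost): it is Borel
measurable, pushes `α` to `β`, and its transport cost realizes the squared Wasserstein
distance. -/
def IsOptimalTransportMap {d : ℕ} {Ω : Set (EuclideanSpace ℝ (Fin d))}
    (T : Ω → Ω) (α β : Measure Ω) : Prop :=
  Measurable T ∧ α.map T = β ∧
    (∫ x, ‖(T x : EuclideanSpace ℝ (Fin d)) - (x : EuclideanSpace ℝ (Fin d))‖ ^ 2 ∂α) = W2sq α β

open TopologicalSpace
open scoped RealInnerProductSpace

/-- The support of an optimal coupling is `c`-monotone: no pair of its points can be made cheaper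
by exchanging the targets. -/
theorem cost_add_le_of_mem_support {X Y : Type*}
    [TopologicalSpace X] [SecondCountableTopology X] [MeasurableSpace X] [BorelSpace X]
    [TopologicalSpace Y] [SecondCountableTopology Y] [MeasurableSpace Y] [BorelSpace Y]
    [CompactSpace X] [CompactSpace Y]
    (c : X × Y → ℝ) (hc : Continuous c) (γ : Measure (X × Y)) [IsProbabilityMeasure γ]
    (hopt : ∀ γ' : Measure (X × Y), IsProbabilityMeasure γ' →
      γ'.map Prod.fst = γ.map Prod.fst → γ'.map Prod.snd = γ.map Prod.snd →
      ∫ p, c p ∂γ ≤ ∫ p, c p ∂γ')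
    {p q : X × Y} (hp : p ∈ γ.support) (hq : q ∈ γ.support) :
    c p + c q ≤ c (p.1, q.2) + c (q.1, p.2) := by
  classical
  let π := γ.prod γ
  let A : Set ((X × Y) × (X × Y)) :=
    {z | c (z.1.1, z.2.2) + c (z.2.1, z.1.2) < c z.1 + c z.2}
  have hAo : IsOpen A := isOpen_lt (by fun_prop) (by fun_prop)
  have hAm : MeasurableSet A := hAo.measurableSet
  have hAswap : ∀ z, z.swap ∈ A ↔ z ∈ A := by
    intro z
    simp only [A, mem_ofPred_eq, Prod.fst_swap, Prod.snd_swap]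
    rw [add_comm (c z.2) (c z.1), add_comm (c (z.2.1, z.1.2))]
  have hswap : MeasurePreserving Prod.swap π π := ⟨measurable_swap, Measure.prod_swap⟩
  let g : (X × Y) × (X × Y) → Y := fun z => if z ∈ A then z.2.2 else z.1.2
  have hg : Measurable g := Measurable.ite hAm (by fun_prop) (by fun_prop)
  let Φ : (X × Y) × (X × Y) → X × Y := fun z => (z.1.1, g z)
  have hΦ : Measurable Φ := by fun_prop
  have hfst : (π.map Φ).map Prod.fst = γ.map Prod.fst := by
    have h1 : π.map Prod.fst = γ := by simp [π]
    conv_rhs => rw [← h1]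
    rw [Measure.map_map measurable_fst hΦ, Measure.map_map measurable_fst measurable_fst]
    rfl
  have hsnd : (π.map Φ).map Prod.snd = γ.map Prod.snd := by
    have h1 : π.map Prod.fst = γ := by simp [π]
    conv_rhs => rw [← h1]
    rw [Measure.map_map measurable_snd hΦ, Measure.map_map measurable_snd measurable_fst]
    ext B hB
    rw [Measure.map_apply (by fun_prop) hB, Measure.map_apply (by fun_prop) hB,
      ← measure_inter_add_sdiff _ hAm, ← measure_inter_add_sdiff ((Prod.snd ∘ Prod.fst) ⁻¹' B) hAm]
    congr 1
    · rw [← hswap.measure_preimage (s := (Prod.snd ∘ Prod.fst) ⁻¹' B ∩ A)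
        (((measurable_snd.comp measurable_fst) hB).inter hAm).nullMeasurableSet]
      congr 1
      ext z
      have := hAswap z
      simp only [mem_inter_iff, mem_preimage, Function.comp, Φ, g, this, Prod.fst_swap]
      constructor <;> rintro ⟨h1, h2⟩ <;> simp_all
    · congr 1
      ext z
      simp only [Set.mem_sdiff, mem_preimage, Function.comp, Φ, g]
      constructor <;> rintro ⟨h1, h2⟩ <;> simp_all
  have hcont_int : ∀ {Z : Type _} [TopologicalSpace Z] [CompactSpace Z] [SecondCountableTopology Z]
      [MeasurableSpace Z] [BorelSpace Z]
      (μ : Measure Z) [IsFiniteMeasure μ] {f : Z → ℝ}, Continuous f → Integrable f μ := by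
    intro Z _ _ _ _ _ μ _ f hf
    exact (BoundedContinuousFunction.mkOfCompact ⟨f, hf⟩).integrable μ
  let e : (X × Y) × (X × Y) → ℝ := fun z => c (z.1.1, z.2.2) - c z.1
  let k : (X × Y) × (X × Y) → ℝ := A.indicator e
  have hk : Integrable k π := (hcont_int π (by fun_prop)).indicator hAm
  have hcost : ∫ p, c p ∂(π.map Φ) = ∫ p, c p ∂γ + ∫ z, k z ∂π := by
    have h1 : ∫ p, c p ∂γ = ∫ z, c z.1 ∂π := by
      have h1 : π.map Prod.fst = γ := by simp [π]
      conv_lhs => rw [← h1]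
      exact integral_map measurable_fst.aemeasurable hc.aestronglyMeasurable
    rw [h1, ← integral_add (hcont_int π (by fun_prop)) hk,
      integral_map hΦ.aemeasurable hc.aestronglyMeasurable]
    congr 1 with z
    by_cases hz : z ∈ A <;> simp [Φ, g, k, e, hz]
  have hk0 : 0 ≤ ∫ z, k z ∂π := by
    have := hopt (π.map Φ) (Measure.isProbabilityMeasure_map hΦ.aemeasurable) hfst hsnd
    linarith
  have hkswap : ∫ z, k z.swap ∂π = ∫ z, k z ∂π :=
    hswap.integral_comp MeasurableEquiv.prodComm.measurableEmbedding k
  have hks : Integrable (fun z => k z.swap) π := hswap.integrable_comp_of_integrable hk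
  have hD : ∀ z, -(k z + k z.swap) =
      A.indicator (fun z => c z.1 + c z.2 - c (z.1.1, z.2.2) - c (z.2.1, z.1.2)) z := by
    intro z
    by_cases hz : z ∈ A
    · simp [k, e, hz, hAswap]; ring
    · simp [k, hz, hAswap]
  have hDpos : 0 ≤ fun z => -(k z + k z.swap) := by
    intro z
    simp only [hD]
    refine indicator_nonneg (fun z hz => ?_) z
    have : c (z.1.1, z.2.2) + c (z.2.1, z.1.2) < c z.1 + c z.2 := hz
    linarith
  have hDint : ∫ z, -(k z + k z.swap) ∂π = 0 := by
    apply le_antisymm _ (integral_nonneg hDpos)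
    rw [integral_neg, integral_add hk hks, hkswap]
    linarith
  have hDae := (integral_eq_zero_iff_of_nonneg hDpos (hk.add hks).neg).1 hDint
  have hA0 : π A = 0 := by
    refine measure_mono_null (fun z hz => ?_) hDae
    have h2 : c (z.1.1, z.2.2) + c (z.2.1, z.1.2) < c z.1 + c z.2 := hz
    intro h3
    have h4 : -(k z + k z.swap) = 0 := h3
    rw [hD, indicator_of_mem hz] at h4
    linarith
  by_contra hlt
  have hmem : A ∈ 𝓝 (p, q) := hAo.mem_nhds (not_le.1 hlt)
  obtain ⟨U, hU, V, hV, hUV⟩ := mem_nhds_prod_iff.1 hmem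
  have h0 : π (U ×ˢ V) = 0 := measure_mono_null hUV hA0
  rw [Measure.prod_prod, mul_eq_zero] at h0
  rw [Measure.mem_support_iff_forall] at hp hq
  rcases h0 with h0 | h0
  · exact (hp U hU).ne' h0
  · exact (hq V hV).ne' h0

/-- A set whose chords make an angle at least `π / 3` with a fixed direction is Lebesgue null. -/
theorem volume_eq_zero_of_abs_inner_le {E : Type*} [NormedAddCommGroup E] [InnerProductSpace ℝ E]
    [FiniteDimensional ℝ E] [MeasurableSpace E] [BorelSpace E] {S : Set E} {u : E} (hu : u ≠ 0)
    (hS : ∀ x ∈ S, ∀ y ∈ S, |⟪x - y, u⟫| ≤ ‖x - y‖ * ‖u‖ / 2) : volume S = 0 := by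
  have hcl : ∀ x ∈ closure S, ∀ y ∈ closure S, |⟪x - y, u⟫| ≤ ‖x - y‖ * ‖u‖ / 2 := by
    have hclosed : IsClosed {z : E × E | |⟪z.1 - z.2, u⟫| ≤ ‖z.1 - z.2‖ * ‖u‖ / 2} :=
      isClosed_le (by fun_prop) (by fun_prop)
    have hsub : closure (S ×ˢ S) ⊆ {z : E × E | |⟪z.1 - z.2, u⟫| ≤ ‖z.1 - z.2‖ * ‖u‖ / 2} :=
      hclosed.closure_subset_iff.2 fun z hz => hS _ hz.1 _ hz.2
    intro x hx y hy
    rw [closure_prod_eq] at hsub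
    exact hsub (mk_mem_prod hx hy)
  have hline : ∀ y : E, ∀ᵐ t : ℝ, y + (LinearMap.toSpanSingleton ℝ E u) t ∈ (closure S)ᶜ := by
    intro y
    have hsub : {t : ℝ | ¬ y + (LinearMap.toSpanSingleton ℝ E u) t ∈ (closure S)ᶜ}.Subsingleton := by
      intro t ht s hs
      simp only [LinearMap.toSpanSingleton_apply, mem_compl_iff, not_not, mem_ofPred_eq] at ht hs
      have h := hcl _ ht _ hs
      rw [add_sub_add_left_eq_sub, ← sub_smul, inner_smul_left, norm_smul,
        real_inner_self_eq_norm_sq, abs_mul, abs_of_nonneg (sq_nonneg ‖u‖), Real.norm_eq_abs] at h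
      have hun : 0 < ‖u‖ := norm_pos_iff.2 hu
      simp only [conj_trivial] at h
      have h2 : |t - s| * ‖u‖ ^ 2 ≤ 0 := by nlinarith
      have h3 : |t - s| ≤ 0 := nonpos_of_mul_nonpos_left h2 (by positivity)
      exact sub_eq_zero.1 (abs_nonpos_iff.1 h3)
    exact hsub.measure_zero _
  have h := ae_mem_of_ae_add_linearMap_mem (LinearMap.toSpanSingleton ℝ E u) volume volume
    isClosed_closure.measurableSet.compl hline
  refine measure_mono_null (fun x hx => ?_) h
  simpa using subset_closure hx

/-- A monotone relation on a finite-dimensional Euclidean space is single-valued outside a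
Lebesgue-null set. -/
theorem volume_multivalued_eq_zero_of_monotone {E : Type*} [NormedAddCommGroup E]
    [InnerProductSpace ℝ E] [FiniteDimensional ℝ E] [MeasurableSpace E] [BorelSpace E]
    {Γ : Set (E × E)} (hΓ : ∀ p ∈ Γ, ∀ q ∈ Γ, 0 ≤ ⟪p.1 - q.1, p.2 - q.2⟫) :
    volume {x | ∃ y y', y ≠ y' ∧ (x, y) ∈ Γ ∧ (x, y') ∈ Γ} = 0 := by
  obtain ⟨D, hDc, hDd⟩ := TopologicalSpace.exists_countable_dense E
  let S : E → E → Set E := fun p p' => {x | ∃ y y', (x, y) ∈ Γ ∧ (x, y') ∈ Γ ∧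
    ‖y - p‖ ≤ ‖p - p'‖ / 4 ∧ ‖y' - p'‖ ≤ ‖p - p'‖ / 4}
  have hS : ∀ p p', p ≠ p' → volume (S p p') = 0 := by
    intro p p' hpp
    have key : ∀ x₁ ∈ S p p', ∀ x₂ ∈ S p p',
        ⟪x₁ - x₂, p - p'⟫ ≤ ‖x₁ - x₂‖ * ‖p - p'‖ / 2 := by
      rintro x₁ ⟨-, y₁, -, h₁, -, hy₁⟩ x₂ ⟨y₂, -, h₂, -, hy₂, -⟩
      have hmono : 0 ≤ ⟪x₁ - x₂, y₁ - y₂⟫ := hΓ _ h₁ _ h₂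
      have hsplit : y₁ - y₂ = (y₁ - p') - (y₂ - p) - (p - p') := by abel
      rw [hsplit, inner_sub_right] at hmono
      have hcs := real_inner_le_norm (x₁ - x₂) ((y₁ - p') - (y₂ - p))
      have hn := norm_sub_le (y₁ - p') (y₂ - p)
      have := mul_le_mul_of_nonneg_left (hn.trans (add_le_add hy₁ hy₂)) (norm_nonneg (x₁ - x₂))
      linarith
    refine volume_eq_zero_of_abs_inner_le (sub_ne_zero.2 hpp) fun x hx y hy => abs_le.2 ⟨?_, ?_⟩
    · have h := key y hy x hx
      rw [← neg_sub x y, inner_neg_left, norm_neg] at h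
      linarith
    · exact key x hx y hy
  refine measure_mono_null (t := ⋃ p ∈ D, ⋃ p' ∈ D, {x | p ≠ p' ∧ x ∈ S p p'}) ?_ ?_
  · rintro x ⟨y, y', hne, hy, hy'⟩
    have hpos : 0 < ‖y - y'‖ / 6 := by
      have := norm_pos_iff.2 (sub_ne_zero.2 hne)
      positivity
    obtain ⟨p, hp, hyp⟩ := hDd.exists_dist_lt y hpos
    obtain ⟨p', hp', hyp'⟩ := hDd.exists_dist_lt y' hpos
    rw [dist_eq_norm] at hyp hyp'
    have htri : ‖y - y'‖ ≤ ‖y - p‖ + ‖p - p'‖ + ‖y' - p'‖ := by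
      rw [show y - y' = (y - p) + (p - p') - (y' - p') by abel]
      exact (norm_sub_le _ _).trans (add_le_add_left (norm_add_le _ _) _)
    simp only [mem_iUnion, mem_ofPred_eq, exists_prop]
    refine ⟨p, hp, p', hp', ?_, y, y', hy, hy', by linarith, by linarith⟩
    rintro rfl
    simp only [sub_self, norm_zero] at htri
    linarith
  · refine (measure_biUnion_null_iff hDc).2 fun p _ => (measure_biUnion_null_iff hDc).2 fun p' _ => ?_
    by_cases h : p = p'
    · simp [h]
    · simpa [h] using hS p p' h

/-- A coupling concentrated on a closed relation which is single-valued almost everywhere is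
induced by a map. -/
theorem exists_measurable_map_eq_of_ae_singleValued {X Y : Type*}
    [TopologicalSpace X] [T2Space X] [MeasurableSpace X] [BorelSpace X]
    [TopologicalSpace Y] [PseudoMetrizableSpace Y] [MeasurableSpace Y] [BorelSpace Y]
    [CompactSpace X] [CompactSpace Y] [Nonempty Y]
    (γ : Measure (X × Y)) {Γ : Set (X × Y)} (hΓ : IsClosed Γ) (hγ : γ Γᶜ = 0)
    (hN : γ.map Prod.fst {x | ∃ y y', y ≠ y' ∧ (x, y) ∈ Γ ∧ (x, y') ∈ Γ} = 0) :
    ∃ T : X → Y, Measurable T ∧ (γ.map Prod.fst).map (fun x => (x, T x)) = γ := by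
  classical
  set N := {x | ∃ y y', y ≠ y' ∧ (x, y) ∈ Γ ∧ (x, y') ∈ Γ} with hNdef
  let M := toMeasurable (γ.map Prod.fst) N
  let G : Set X := (Prod.fst '' Γ) \ M
  have hproj : ∀ K : Set (X × Y), IsClosed K → MeasurableSet (Prod.fst '' K) := fun K hK =>
    (hK.isCompact.image continuous_fst).isClosed.measurableSet
  have hGm : MeasurableSet G := (hproj Γ hΓ).diff (measurableSet_toMeasurable _ _)
  let T : X → Y := fun x => if h : ∃ y, (x, y) ∈ Γ ∧ x ∉ M then h.choose else Classical.arbitrary Y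
  have hTΓ : ∀ x ∉ M, ∀ y, (x, y) ∈ Γ → T x = y := by
    intro x hx y hy
    have h : ∃ y, (x, y) ∈ Γ ∧ x ∉ M := ⟨y, hy, hx⟩
    have hT : T x = h.choose := dif_pos h
    by_contra hne
    exact hx (subset_toMeasurable _ _ ⟨T x, y, hne, hT ▸ h.choose_spec.1, hy⟩)
  have hTm : Measurable T := by
    refine measurable_of_isClosed fun C hC => ?_
    have hpre : T ⁻¹' C = (Prod.fst '' (Γ ∩ Prod.snd ⁻¹' C) ∩ G) ∪
        (Gᶜ ∩ {_x | Classical.arbitrary Y ∈ C}) := by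
      ext x
      by_cases hx : x ∈ G
      · obtain ⟨⟨⟨x', y⟩, hy, rfl⟩, hxM⟩ := hx
        have hxG : x' ∈ G := ⟨⟨(x', y), hy, rfl⟩, hxM⟩
        have hTy := hTΓ x' hxM y hy
        simp only [mem_preimage, mem_union, mem_inter_iff, hxG, and_true, mem_compl_iff,
          not_true, false_and, or_false, mem_image, Prod.exists, exists_and_right, exists_eq_right]
        constructor
        · intro h
          exact ⟨y, hy, hTy ▸ h⟩
        · rintro ⟨y', hy', hC'⟩
          rwa [hTΓ x' hxM y' hy']
      · have h : ¬ ∃ y, (x, y) ∈ Γ ∧ x ∉ M := fun ⟨y, hy, hxM⟩ => hx ⟨⟨(x, y), hy, rfl⟩, hxM⟩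
        have hT : T x = Classical.arbitrary Y := dif_neg h
        simp [hx, hT]
    rw [hpre]
    exact ((hproj _ (hΓ.inter (hC.preimage continuous_snd))).inter hGm).union
      (hGm.compl.inter (MeasurableSet.const _))
  refine ⟨T, hTm, ?_⟩
  have hM0 : γ (Prod.fst ⁻¹' M) = 0 := by
    rw [← Measure.map_apply measurable_fst (measurableSet_toMeasurable _ _), measure_toMeasurable]
    exact hN
  rw [Measure.map_map (by fun_prop) measurable_fst]
  conv_rhs => rw [← Measure.map_id (μ := γ)]
  refine Measure.map_congr ?_
  have h1 : ∀ᵐ p ∂γ, p ∈ Γ := by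
    rw [ae_iff]; exact hγ
  have h2 : ∀ᵐ p ∂γ, p.1 ∉ M := by
    simp only [ae_iff, not_not]; exact hM0
  filter_upwards [h1, h2] with p hp hpM
  exact Prod.ext rfl (hTΓ p.1 hpM p.2 hp)

/-- **Brenier's theorem** for a compact domain: an optimal coupling for the quadratic cost whose
first marginal is absolutely continuous is induced by a map. -/
theorem exists_measurable_map_eq_of_optimal {E : Type*} [NormedAddCommGroup E]
    [InnerProductSpace ℝ E] [FiniteDimensional ℝ E] [MeasurableSpace E] [BorelSpace E]
    {Ω : Set E} (hΩ : IsCompact Ω) (γ : Measure (Ω × Ω)) [IsProbabilityMeasure γ]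
    (hac : (γ.map Prod.fst).map Subtype.val ≪ (volume : Measure E))
    (hopt : ∀ γ' : Measure (Ω × Ω), IsProbabilityMeasure γ' →
      γ'.map Prod.fst = γ.map Prod.fst → γ'.map Prod.snd = γ.map Prod.snd →
      ∫ p, ‖(p.1 : E) - (p.2 : E)‖ ^ 2 ∂γ ≤ ∫ p, ‖(p.1 : E) - (p.2 : E)‖ ^ 2 ∂γ') :
    ∃ T : Ω → Ω, Measurable T ∧ (γ.map Prod.fst).map (fun x => (x, T x)) = γ := by
  have : CompactSpace Ω := isCompact_iff_compactSpace.1 hΩ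
  have : SecondCountableTopology E := secondCountable_of_proper
  have : Nonempty Ω := (nonempty_of_isProbabilityMeasure γ).map Prod.fst
  refine exists_measurable_map_eq_of_ae_singleValued γ Measure.isClosed_support
    Measure.measure_compl_support ?_
  let Γ : Set (E × E) := Prod.map Subtype.val Subtype.val '' γ.support
  have hΓ : ∀ p ∈ Γ, ∀ q ∈ Γ, 0 ≤ ⟪p.1 - q.1, p.2 - q.2⟫ := by
    rintro _ ⟨p, hp, rfl⟩ _ ⟨q, hq, rfl⟩
    have h := cost_add_le_of_mem_support (fun p : Ω × Ω => ‖(p.1 : E) - (p.2 : E)‖ ^ 2)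
      (by fun_prop) γ hopt hp hq
    simp only [Prod.map_fst, Prod.map_snd, inner_sub_left, inner_sub_right, norm_sub_sq_real] at h ⊢
    linarith
  have hnull := hac (volume_multivalued_eq_zero_of_monotone hΓ)
  refine measure_mono_null ?_ (Measure.preimage_null_of_map_null
    measurable_subtype_coe.aemeasurable hnull)
  rintro x ⟨y, y', hne, hy, hy'⟩
  exact ⟨y, y', fun h => hne (Subtype.ext h), ⟨(x, y), hy, rfl⟩, ⟨(x, y'), hy', rfl⟩⟩

/-- The functional `C(T,F) = ℒ(F, T_♯ρ) + (1/(2τ)) ∫ ‖T(x) - x‖² dρ` attains its infimum over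
Borel maps `T : Ω → Ω` and `F ∈ ℱ` at a pair `(T*, F*)` with `T*` an optimal transport map
from `ρ` to `T*_♯ρ`. -/
theorem regularized_modulewise_problem_has_OT_minimizer
    {d : ℕ} (hd : 1 ≤ d) (Ω : Set (EuclideanSpace ℝ (Fin d)))
    (hΩcompact : IsCompact Ω) (hΩconvex : Convex ℝ Ω)
    (ρ : ProbabilityMeasure Ω)
    (hρac : (ρ : Measure Ω).map Subtype.val ≪ (volume : Measure (EuclideanSpace ℝ (Fin d))))
    (𝓕 : Type*) [TopologicalSpace 𝓕] [CompactSpace 𝓕] [Nonempty 𝓕]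
    (L : 𝓕 → ProbabilityMeasure Ω → ℝ)
    (hLcont : Continuous fun p : 𝓕 × ProbabilityMeasure Ω => L p.1 p.2)
    (hLnonneg : ∀ F μ, 0 ≤ L F μ)
    (τ : ℝ) (hτ : 0 < τ) :
    ∃ (Tstar : Ω → Ω) (hTstar : Measurable Tstar) (Fstar : 𝓕),
      (∀ (T : Ω → Ω) (hT : Measurable T) (F : 𝓕),
        L Fstar (ρ.map hTstar.aemeasurable) +
          (1 / (2 * τ)) * ∫ x, ‖(Tstar x : EuclideanSpace ℝ (Fin d)) -
            (x : EuclideanSpace ℝ (Fin d))‖ ^ 2 ∂(ρ : Measure Ω)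
        ≤ L F (ρ.map hT.aemeasurable) +
          (1 / (2 * τ)) * ∫ x, ‖(T x : EuclideanSpace ℝ (Fin d)) -
            (x : EuclideanSpace ℝ (Fin d))‖ ^ 2 ∂(ρ : Measure Ω)) ∧
      IsOptimalTransportMap Tstar (ρ : Measure Ω) ((ρ : Measure Ω).map Tstar) := by
  classical
  have : CompactSpace Ω := isCompact_iff_compactSpace.1 hΩcompact
  let c : Ω × Ω → ℝ := fun p =>
    ‖(p.1 : EuclideanSpace ℝ (Fin d)) - (p.2 : EuclideanSpace ℝ (Fin d))‖ ^ 2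
  have hc : Continuous c := by fun_prop
  have hfst : Continuous fun γ : ProbabilityMeasure (Ω × Ω) =>
      γ.map (f := Prod.fst) measurable_fst.aemeasurable :=
    ProbabilityMeasure.continuous_map continuous_fst
  have hsnd : Continuous fun γ : ProbabilityMeasure (Ω × Ω) =>
      γ.map (f := Prod.snd) measurable_snd.aemeasurable :=
    ProbabilityMeasure.continuous_map continuous_snd
  have hcint : Continuous fun γ : ProbabilityMeasure (Ω × Ω) =>
      ∫ p, c p ∂(γ : Measure (Ω × Ω)) :=
    ProbabilityMeasure.continuous_integral_boundedContinuousFunction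
      (BoundedContinuousFunction.mkOfCompact ⟨c, hc⟩)
  let J : 𝓕 × ProbabilityMeasure (Ω × Ω) → ℝ := fun z =>
    L z.1 (z.2.map (f := Prod.snd) measurable_snd.aemeasurable) +
      (1 / (2 * τ)) * ∫ p, c p ∂(z.2 : Measure (Ω × Ω))
  have hJ : Continuous J :=
    (hLcont.comp (continuous_fst.prodMk (hsnd.comp continuous_snd))).add
      (continuous_const.mul (hcint.comp continuous_snd))
  let K : Set (𝓕 × ProbabilityMeasure (Ω × Ω)) :=
    {z | z.2.map (f := Prod.fst) measurable_fst.aemeasurable = ρ}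
  have hK : IsCompact K :=
    (isClosed_eq (hfst.comp continuous_snd) continuous_const).isCompact
  have hgraph : ∀ T : Ω → Ω, Measurable T → AEMeasurable (fun x => (x, T x)) (ρ : Measure Ω) :=
    fun T hT => (measurable_id.prodMk hT).aemeasurable
  have hgraphK : ∀ (T : Ω → Ω) (hT : Measurable T) (F : 𝓕),
      (F, ρ.map (hgraph T hT)) ∈ K := by
    intro T hT F
    apply Subtype.ext
    change ((ρ : Measure Ω).map (fun x => (x, T x))).map Prod.fst = ρ
    rw [Measure.map_map measurable_fst (by fun_prop)]
    exact Measure.map_id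
  have hcostgraph : ∀ (T : Ω → Ω), Measurable T →
      ∫ p, c p ∂((ρ : Measure Ω).map (fun x => (x, T x))) =
        ∫ x, ‖(T x : EuclideanSpace ℝ (Fin d)) -
            (x : EuclideanSpace ℝ (Fin d))‖ ^ 2 ∂(ρ : Measure Ω) := by
    intro T hT
    rw [integral_map (hgraph T hT) hc.aestronglyMeasurable]
    simp only [c, norm_sub_rev]
  have hJgraph : ∀ (T : Ω → Ω) (hT : Measurable T) (F : 𝓕),
      J (F, ρ.map (hgraph T hT)) = L F (ρ.map hT.aemeasurable) +
          (1 / (2 * τ)) * ∫ x, ‖(T x : EuclideanSpace ℝ (Fin d)) -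
            (x : EuclideanSpace ℝ (Fin d))‖ ^ 2 ∂(ρ : Measure Ω) := by
    intro T hT F
    have h1 : (ρ.map (hgraph T hT)).map (f := Prod.snd) measurable_snd.aemeasurable =
        ρ.map hT.aemeasurable := by
      apply Subtype.ext
      change ((ρ : Measure Ω).map (fun x => (x, T x))).map Prod.snd = (ρ : Measure Ω).map T
      rw [Measure.map_map measurable_snd (by fun_prop)]
      rfl
    simp only [J, h1]
    rw [← hcostgraph T hT]
    rfl
  obtain ⟨F₀⟩ := ‹Nonempty 𝓕›
  obtain ⟨⟨Fs, γ⟩, hγK, hmin⟩ :=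
    hK.exists_isMinOn ⟨_, hgraphK id measurable_id F₀⟩ hJ.continuousOn
  have hγfst : (γ : Measure (Ω × Ω)).map Prod.fst = ρ :=
    congrArg (fun μ : ProbabilityMeasure Ω => (μ : Measure Ω)) hγK
  have hopt : ∀ γ' : Measure (Ω × Ω), IsProbabilityMeasure γ' →
      γ'.map Prod.fst = (γ : Measure (Ω × Ω)).map Prod.fst →
      γ'.map Prod.snd = (γ : Measure (Ω × Ω)).map Prod.snd →
      ∫ p, c p ∂(γ : Measure (Ω × Ω)) ≤ ∫ p, c p ∂γ' := by
    intro γ' hγ' h1 h2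
    have hmem : (Fs, (⟨γ', hγ'⟩ : ProbabilityMeasure (Ω × Ω))) ∈ K :=
      Subtype.ext (h1.trans hγfst)
    have hle : J (Fs, γ) ≤ J (Fs, ⟨γ', hγ'⟩) := hmin hmem
    have hsame : ProbabilityMeasure.map (⟨γ', hγ'⟩ : ProbabilityMeasure (Ω × Ω))
        (f := Prod.snd) measurable_snd.aemeasurable =
        γ.map (f := Prod.snd) measurable_snd.aemeasurable := Subtype.ext h2
    simp only [J, hsame] at hle
    exact le_of_mul_le_mul_left (le_of_add_le_add_left hle) (by positivity)
  obtain ⟨T, hT, hTγ⟩ := exists_measurable_map_eq_of_optimal hΩcompact (γ : Measure (Ω × Ω))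
    (by rwa [hγfst]) hopt
  rw [hγfst] at hTγ
  have hγT : ρ.map (hgraph T hT) = γ := Subtype.ext hTγ
  have hγsnd : (γ : Measure (Ω × Ω)).map Prod.snd = (ρ : Measure Ω).map T := by
    rw [← hTγ, Measure.map_map measurable_snd (by fun_prop)]
    rfl
  refine ⟨T, hT, Fs, fun T' hT' F => ?_, hT, rfl, ?_⟩
  · rw [← hJgraph T hT, ← hJgraph T' hT', hγT]
    exact hmin (hgraphK T' hT' F)
  · rw [← hcostgraph T hT, hTγ]
    symm
    apply IsLeast.csInf_eq
    refine ⟨⟨γ, inferInstance, hγfst, hγsnd, rfl⟩, ?_⟩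
    rintro _ ⟨γ', hγ', h1, h2, rfl⟩
    exact hopt γ' hγ' (h1.trans hγfst.symm) (h2.trans hγsnd.symm)
end

section
/- Let d ≥ 1, let Ω ⊂ ℝ^d be a compact convex set, let ρ be a Borel probability measure on Ω that is absolutely continuous with respect to Lebesgue measure, let ℱ be a compact topological space, let ℒ : ℱ × P(Ω) → ℝ be jointly continuous and nonnegative, and let τ > 0. Define C(T, F) = ℒ(F, T_♯ρ) + (1/(2τ)) ∫_Ω ‖T(x) − x‖² dρ(x) over Borel measurable maps T : Ω → Ω and F ∈ ℱ. Then for every minimizing pair (T*, F*) of C (i.e., every pair attaining the infimum of C), the map T* is an optimal transport map from ρ to T*_♯ρ. -/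
open MeasureTheory Filter Topology Set

section Transport

open ProbabilityTheory unitInterval

/-- The cumulative distribution function of an atomless probability measure on `ℝ` pushes it
forward to the uniform measure on the unit interval. -/
lemma exists_measurable_map_eq_volume_unitInterval_of_real (μ : Measure ℝ)
    [IsProbabilityMeasure μ] [NullSingletonClass μ] :
    ∃ F : ℝ → I, Measurable F ∧ μ.map F = volume := by
  let F : ℝ → I := fun x ↦ ⟨cdf μ x, cdf_nonneg μ x, cdf_le_one μ x⟩
  have hmono : Monotone F := fun x y h ↦ monotone_cdf μ h
  have hcont : Continuous (cdf μ) := by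
    refine continuous_iff_continuousAt.2 fun x ↦ ?_
    rw [(monotone_cdf μ).continuousAt_iff_leftLim_eq_rightLim, (cdf μ).rightLim_eq]
    have h := (cdf μ).measure_singleton x
    rw [measure_cdf, measure_singleton] at h
    have h1 := ENNReal.ofReal_eq_zero.1 h.symm
    have h2 := (monotone_cdf μ).leftLim_le (le_refl x)
    linarith
  refine ⟨F, hmono.measurable, ?_⟩
  have : IsProbabilityMeasure (μ.map F) :=
    Measure.isProbabilityMeasure_map hmono.measurable.aemeasurable
  refine Measure.ext_of_Iic _ _ fun t ↦ ?_
  rw [Measure.map_apply hmono.measurable measurableSet_Iic, unitInterval.volume_Iic]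
  rcases eq_or_lt_of_le t.2.2 with ht | ht
  · have : F ⁻¹' Iic t = univ := by
      refine eq_univ_of_forall fun x ↦ ?_
      change cdf μ x ≤ t
      rw [ht]; exact cdf_le_one μ x
    rw [this, ht]; simp
  set S : Set ℝ := F ⁻¹' Iic t with hS
  have hmem : ∀ x, x ∈ S ↔ cdf μ x ≤ t := fun x ↦ Iff.rfl
  obtain ⟨M, hM⟩ := ((tendsto_cdf_atTop μ).eventually (lt_mem_nhds ht)).exists
  have hbdd : BddAbove S := by
    refine ⟨M, fun x hx ↦ ?_⟩
    by_contra! h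
    have := monotone_cdf μ h.le
    have := (hmem x).1 hx
    linarith
  have hclosed : IsClosed S := isClosed_le hcont continuous_const
  rcases S.eq_empty_or_nonempty with he | hne
  · have : (t : ℝ) ≤ 0 := by
      by_contra! h
      obtain ⟨x, hx⟩ := ((tendsto_cdf_atBot μ).eventually (gt_mem_nhds h)).exists
      have : x ∈ S := (hmem x).2 hx.le
      simp [he] at this
    rw [he, measure_empty, ENNReal.ofReal_of_nonpos this]
  have hb : sSup S ∈ S := hclosed.csSup_mem hne hbdd
  have hSb : S = Iic (sSup S) := by
    ext x
    refine ⟨fun hx ↦ le_csSup hbdd hx, fun hx ↦ (hmem x).2 ?_⟩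
    exact (monotone_cdf μ hx).trans ((hmem _).1 hb)
  have hval : cdf μ (sSup S) = t := by
    refine le_antisymm ((hmem _).1 hb) ?_
    obtain ⟨a, ha⟩ : ∃ a, cdf μ a = t :=
      mem_range_of_exists_le_of_exists_ge hcont ⟨_, (hmem _).1 hb⟩ ⟨M, hM.le⟩
    rw [← ha]
    exact monotone_cdf μ (le_csSup hbdd ((hmem a).2 ha.le))
  rw [hSb, ← ofReal_cdf, hval]

/-- An atomless probability measure on a standard Borel space can be transported by a measurable
map to any probability measure on a standard Borel space. -/
lemma exists_measurable_map_eq_of_atomless {X Y : Type*} [MeasurableSpace X] [StandardBorelSpace X]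
    [MeasurableSpace Y] [StandardBorelSpace Y] (μ : Measure X) [IsProbabilityMeasure μ] [NullSingletonClass μ]
    (ν : Measure Y) [IsProbabilityMeasure ν] :
    ∃ T : X → Y, Measurable T ∧ μ.map T = ν := by
  have : Nonempty Y := nonempty_of_isProbabilityMeasure ν
  have he := measurableEmbedding_embeddingReal X
  have : IsProbabilityMeasure (μ.map (embeddingReal X)) :=
    Measure.isProbabilityMeasure_map he.measurable.aemeasurable
  have : NullSingletonClass (μ.map (embeddingReal X)) := ⟨fun x ↦ by
    rw [he.map_apply]
    exact (subsingleton_singleton.preimage he.injective).measure_zero μ⟩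
  obtain ⟨F, hF, hFμ⟩ :=
    exists_measurable_map_eq_volume_unitInterval_of_real (μ.map (embeddingReal X))
  obtain ⟨f, hf, hfν⟩ := ν.exists_measurable_map_eq
  refine ⟨f ∘ F ∘ embeddingReal X, hf.comp (hF.comp he.measurable), ?_⟩
  rw [← Measure.map_map hf (hF.comp he.measurable), ← Measure.map_map hF he.measurable, hFμ, hfν]

/-- Version of `exists_measurable_map_eq_of_atomless` for finite measures of equal mass. -/
lemma exists_measurable_map_eq_of_atomless_of_measure_univ_eq {X Y : Type*} [MeasurableSpace X]
    [StandardBorelSpace X] [MeasurableSpace Y] [StandardBorelSpace Y] [Nonempty Y]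
    (μ : Measure X) [IsFiniteMeasure μ] [NullSingletonClass μ] (ν : Measure Y) (h : μ univ = ν univ) :
    ∃ T : X → Y, Measurable T ∧ μ.map T = ν := by
  rcases eq_or_ne (μ univ) 0 with h0 | h0
  · refine ⟨fun _ ↦ Classical.arbitrary Y, measurable_const, ?_⟩
    have hμ : μ = 0 := Measure.measure_univ_eq_zero.1 h0
    have hν : ν = 0 := Measure.measure_univ_eq_zero.1 (h ▸ h0)
    rw [hμ, hν, Measure.map_zero]
  have hT : μ univ ≠ ⊤ := measure_ne_top μ univ
  have : IsProbabilityMeasure ((μ univ)⁻¹ • μ) := ⟨by simp [ENNReal.inv_mul_cancel h0 hT]⟩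
  have : IsProbabilityMeasure ((μ univ)⁻¹ • ν) :=
    ⟨by simp [← h, ENNReal.inv_mul_cancel h0 hT]⟩
  have : NullSingletonClass ((μ univ)⁻¹ • μ) := ⟨fun x ↦ by simp⟩
  obtain ⟨T, hT', hTν⟩ :=
    exists_measurable_map_eq_of_atomless ((μ univ)⁻¹ • μ) ((μ univ)⁻¹ • ν)
  refine ⟨T, hT', ?_⟩
  rw [Measure.map_smul] at hTν
  have := congrArg ((μ univ) • ·) hTν
  simpa [smul_smul, ENNReal.mul_inv_cancel h0 hT] using this

/-- Given a coupling `γ` with atomless first marginal `ρ` and a countable measurable partition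
(the fibres of `c`), there is a map `T` such that `(id, T)_♯ ρ` and `γ` agree on all sets
`A × B` with `A` a union of cells of the partition. -/
lemma exists_measurable_map_prodMk_eq {X Y ι : Type*} [MeasurableSpace X] [StandardBorelSpace X]
    [MeasurableSpace Y] [StandardBorelSpace Y] [Nonempty Y] [MeasurableSpace ι] [Countable ι]
    [MeasurableSingletonClass ι] (γ : Measure (X × Y)) [IsFiniteMeasure γ] [NullSingletonClass γ.fst]
    {c : X → ι} (hc : Measurable c) :
    ∃ T : X → Y, Measurable T ∧
      γ.fst.map (fun x ↦ (c x, T x)) = γ.map (fun p ↦ (c p.1, p.2)) := by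
  have hcell (i : ι) : MeasurableSet (c ⁻¹' {i}) := hc (measurableSet_singleton i)
  have hpiece (i : ι) : ∃ T : X → Y, Measurable T ∧
      (γ.fst.restrict (c ⁻¹' {i})).map T = (γ.restrict (Prod.fst ⁻¹' (c ⁻¹' {i}))).snd := by
    apply exists_measurable_map_eq_of_atomless_of_measure_univ_eq
    rw [Measure.snd_univ]
    simp [Measure.fst_apply (hcell i)]
  choose T hT hTγ using hpiece
  have hTc : Measurable fun x ↦ T (c x) x := by
    have : Measurable fun p : ι × X ↦ T p.1 p.2 := measurable_from_prod_countable_right hT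
    exact this.comp (hc.prodMk measurable_id)
  refine ⟨fun x ↦ T (c x) x, hTc, ?_⟩
  have hm : Measurable fun p : X × Y ↦ (c p.1, p.2) := (hc.comp measurable_fst).prodMk measurable_snd
  refine Measure.ext fun s hs ↦ ?_
  have hs' : s = ⋃ i : ι, Prod.fst ⁻¹' {i} ∩ s := by ext; simp
  rw [hs']
  have hd : Pairwise (Function.onFun Disjoint fun i : ι ↦ (Prod.fst ⁻¹' {i} ∩ s : Set (ι × Y))) := by
    intro i j hij
    refine Set.disjoint_left.2 fun p hp hq ↦ hij ?_
    exact (show p.1 = i from hp.1).symm.trans hq.1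
  have hms (i : ι) : MeasurableSet (Prod.fst ⁻¹' {i} ∩ s : Set (ι × Y)) :=
    (measurable_fst (measurableSet_singleton i)).inter hs
  rw [measure_iUnion hd hms, measure_iUnion hd hms]
  refine tsum_congr fun i ↦ ?_
  rw [Measure.map_apply (hc.prodMk hTc) (hms i), Measure.map_apply hm (hms i)]
  have hB : MeasurableSet (Prod.mk i ⁻¹' s : Set Y) := measurable_prodMk_left hs
  have h := congrArg (fun m ↦ m (Prod.mk i ⁻¹' s)) (hTγ i)
  simp only [Measure.map_apply (hT i) hB, Measure.snd_apply hB] at h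
  rw [Measure.restrict_apply (hT i hB), Measure.restrict_apply (measurable_snd hB)] at h
  convert h using 2
  · ext x
    simp only [mem_preimage, mem_inter_iff, mem_singleton_iff]
    constructor
    · rintro ⟨rfl, hx⟩; exact ⟨hx, rfl⟩
    · rintro ⟨hx, rfl⟩; exact ⟨rfl, hx⟩
  · ext x
    simp only [mem_preimage, mem_inter_iff, mem_singleton_iff]
    constructor
    · rintro ⟨rfl, hx⟩; exact ⟨hx, rfl⟩
    · rintro ⟨hx, rfl⟩; exact ⟨rfl, hx⟩

/-- In a separable metric space, points can be measurably and uniformly approximated by points of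
a sequence. -/
lemma exists_measurable_nat_dist_lt (X : Type*) [PseudoMetricSpace X]
    [TopologicalSpace.SeparableSpace X] [MeasurableSpace X] [OpensMeasurableSpace X] [Nonempty X]
    {ε : ℝ} (hε : 0 < ε) :
    ∃ (c : X → ℕ) (q : ℕ → X), Measurable c ∧ ∀ x, dist x (q (c x)) < ε := by
  classical
  have h (x : X) : ∃ n, dist x (TopologicalSpace.denseSeq X n) < ε :=
    (TopologicalSpace.denseRange_denseSeq X).exists_dist_lt x hε
  refine ⟨fun x ↦ Nat.find (h x), TopologicalSpace.denseSeq X, ?_, fun x ↦ Nat.find_spec (h x)⟩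
  refine measurable_find h fun n ↦ ?_
  exact (isOpen_lt (continuous_id.dist continuous_const) continuous_const).measurableSet

/-- A coupling with atomless first marginal can be replaced by a transport map with the same
marginals, at an arbitrarily small increase of the cost. -/
lemma exists_measurable_map_eq_integral_le {X : Type*} [MetricSpace X] [CompactSpace X]
    [Nonempty X] [MeasurableSpace X] [BorelSpace X] {k : X × X → ℝ} (hk : Continuous k)
    (γ : Measure (X × X)) [IsProbabilityMeasure γ] [NullSingletonClass γ.fst] {ε : ℝ} (hε : 0 < ε) :
    ∃ T : X → X, Measurable T ∧ γ.fst.map T = γ.snd ∧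
      ∫ x, k (x, T x) ∂γ.fst ≤ ∫ p, k p ∂γ + ε := by
  obtain ⟨δ, hδ, hkδ⟩ := Metric.uniformContinuous_iff.1
    (CompactSpace.uniformContinuous_of_continuous hk) (ε / 2) (half_pos hε)
  obtain ⟨c, q, hc, hq⟩ := exists_measurable_nat_dist_lt X hδ
  obtain ⟨T, hT, hTγ⟩ := exists_measurable_map_prodMk_eq γ hc
  have hm : Measurable fun p : X × X ↦ (c p.1, p.2) :=
    (hc.comp measurable_fst).prodMk measurable_snd
  have hmT : Measurable fun x ↦ (c x, T x) := hc.prodMk hT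
  have hkq : Measurable fun p : ℕ × X ↦ k (q p.1, p.2) :=
    measurable_from_prod_countable_right fun n ↦ by fun_prop
  obtain ⟨C, hC⟩ := (isCompact_range hk).isBounded.exists_norm_le
  have hC' (p : X × X) : ‖k p‖ ≤ C := hC _ (mem_range_self p)
  have hclose (x y : X) : dist (k (x, y)) (k (q (c x), y)) < ε / 2 := by
    apply hkδ
    simpa [Prod.dist_eq] using hq x
  refine ⟨T, hT, ?_, ?_⟩
  · have := congrArg (Measure.map Prod.snd) hTγ
    rwa [Measure.map_map measurable_snd hmT, Measure.map_map measurable_snd hm] at this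
  have heq : ∫ x, k (q (c x), T x) ∂γ.fst = ∫ p, k (q (c p.1), p.2) ∂γ := by
    rw [← integral_map (f := fun p : ℕ × X ↦ k (q p.1, p.2)) hmT.aemeasurable
      hkq.aestronglyMeasurable, hTγ, integral_map hm.aemeasurable hkq.aestronglyMeasurable]
  have hi1 : Integrable (fun x ↦ k (x, T x)) γ.fst :=
    .of_bound (hk.measurable.comp (measurable_id.prodMk hT)).aestronglyMeasurable C
      (.of_forall fun x ↦ hC' _)
  have hi2 : Integrable (fun x ↦ k (q (c x), T x)) γ.fst :=
    .of_bound (hkq.comp hmT).aestronglyMeasurable C (.of_forall fun x ↦ hC' _)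
  have hi3 : Integrable (fun p : X × X ↦ k (q (c p.1), p.2)) γ :=
    .of_bound (hkq.comp hm).aestronglyMeasurable C (.of_forall fun x ↦ hC' _)
  have hi4 : Integrable k γ :=
    .of_bound hk.measurable.aestronglyMeasurable C (.of_forall hC')
  have h1 : ∫ x, k (x, T x) ∂γ.fst ≤ ∫ x, (k (q (c x), T x) + ε / 2) ∂γ.fst := by
    refine integral_mono hi1 (hi2.add (integrable_const _)) fun x ↦ ?_
    have := (abs_lt.1 (hclose x (T x))).2
    dsimp only
    linarith
  have h2 : ∫ p, k (q (c p.1), p.2) ∂γ ≤ ∫ p, (k p + ε / 2) ∂γ := by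
    refine integral_mono hi3 (hi4.add (integrable_const _)) fun p ↦ ?_
    have := (abs_lt.1 (hclose p.1 p.2)).1
    dsimp only
    linarith
  rw [integral_add hi2 (integrable_const _)] at h1
  rw [integral_add hi4 (integrable_const _)] at h2
  simp only [integral_const, probReal_univ, one_smul] at h1 h2
  linarith

end Transport

/-- Every minimizer `(T*, F*)` of the functional
`C(T,F) = ℒ(F, T_♯ρ) + (1/(2τ)) ∫ ‖T(x) - x‖² dρ` over Borel maps `T : Ω → Ω` and `F ∈ ℱ`
is such that `T*` is an optimal transport map from `ρ` to `T*_♯ρ`. -/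
theorem minimizer_of_regularized_modulewise_problem_is_OT
    {d : ℕ} (hd : 1 ≤ d) (Ω : Set (EuclideanSpace ℝ (Fin d)))
    (hΩcompact : IsCompact Ω) (hΩconvex : Convex ℝ Ω)
    (ρ : ProbabilityMeasure Ω)
    (hρac : (ρ : Measure Ω).map Subtype.val ≪ (volume : Measure (EuclideanSpace ℝ (Fin d))))
    (𝓕 : Type*) [TopologicalSpace 𝓕] [CompactSpace 𝓕]
    (L : 𝓕 → ProbabilityMeasure Ω → ℝ)
    (hLcont : Continuous fun p : 𝓕 × ProbabilityMeasure Ω => L p.1 p.2)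
    (hLnonneg : ∀ F μ, 0 ≤ L F μ)
    (τ : ℝ) (hτ : 0 < τ)
    (Tstar : Ω → Ω) (hTstar : Measurable Tstar) (Fstar : 𝓕)
    (hmin : ∀ (T : Ω → Ω) (hT : Measurable T) (F : 𝓕),
        L Fstar (ρ.map hTstar.aemeasurable) +
          (1 / (2 * τ)) * ∫ x, ‖(Tstar x : EuclideanSpace ℝ (Fin d)) -
            (x : EuclideanSpace ℝ (Fin d))‖ ^ 2 ∂(ρ : Measure Ω)
        ≤ L F (ρ.map hT.aemeasurable) +
          (1 / (2 * τ)) * ∫ x, ‖(T x : EuclideanSpace ℝ (Fin d)) -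
            (x : EuclideanSpace ℝ (Fin d))‖ ^ 2 ∂(ρ : Measure Ω)) :
    IsOptimalTransportMap Tstar (ρ : Measure Ω) ((ρ : Measure Ω).map Tstar) := by
  have : Nonempty (Fin d) := ⟨⟨0, hd⟩⟩
  have : CompactSpace Ω := isCompact_iff_compactSpace.1 hΩcompact
  have : Nonempty Ω := nonempty_of_isProbabilityMeasure (ρ : Measure Ω)
  have hatoms : NullSingletonClass (ρ : Measure Ω) := ⟨fun x ↦ by
    have h := hρac (measure_singleton (x : EuclideanSpace ℝ (Fin d)))
    rw [Measure.map_apply measurable_subtype_coe (measurableSet_singleton _)] at h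
    exact measure_mono_null (by simp) h⟩
  let k : Ω × Ω → ℝ := fun p ↦
    ‖(p.1 : EuclideanSpace ℝ (Fin d)) - (p.2 : EuclideanSpace ℝ (Fin d))‖ ^ 2
  have hk : Continuous k := by fun_prop
  have hkT (T : Ω → Ω) : (fun x : Ω ↦ ‖(T x : EuclideanSpace ℝ (Fin d)) -
      (x : EuclideanSpace ℝ (Fin d))‖ ^ 2) = fun x ↦ k (x, T x) := by
    funext x
    rw [norm_sub_rev]
  refine ⟨hTstar, rfl, le_antisymm (le_csInf ?_ ?_) (csInf_le ⟨0, ?_⟩ ?_)⟩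
  · refine ⟨_, (ρ : Measure Ω).map (fun x ↦ (x, Tstar x)),
      Measure.isProbabilityMeasure_map (by fun_prop), ?_, ?_, rfl⟩
    · rw [Measure.map_map measurable_fst (by fun_prop)]; exact Measure.map_id
    · rw [Measure.map_map measurable_snd (by fun_prop)]; rfl
  · rintro _ ⟨γ, hγ, hfst, hsnd, rfl⟩
    change γ.fst = _ at hfst
    change γ.snd = _ at hsnd
    refine le_of_forall_pos_le_add fun ε hε ↦ ?_
    have : NullSingletonClass γ.fst := hfst ▸ hatoms
    obtain ⟨T, hT, hTγ, hcost⟩ := exists_measurable_map_eq_integral_le hk γ hε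
    rw [hfst] at hTγ hcost
    have hmap : ρ.map hT.aemeasurable = ρ.map hTstar.aemeasurable :=
      Subtype.ext (hTγ.trans hsnd)
    have h := hmin T hT Fstar
    rw [hmap] at h
    have h' := le_of_mul_le_mul_left (le_of_add_le_add_left h) (by positivity)
    rw [hkT T] at h'
    exact h'.trans hcost
  · rintro _ ⟨γ, -, -, -, rfl⟩
    exact integral_nonneg fun p ↦ by positivity
  · refine ⟨(ρ : Measure Ω).map (fun x ↦ (x, Tstar x)),
      Measure.isProbabilityMeasure_map (by fun_prop), ?_, ?_, ?_⟩
    · rw [Measure.map_map measurable_fst (by fun_prop)]; exact Measure.map_id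
    · rw [Measure.map_map measurable_snd (by fun_prop)]; rfl
    · rw [hkT, integral_map (by fun_prop) hk.measurable.aestronglyMeasurable]
end

section
/- Let d ≥ 1, let Ω ⊂ ℝ^d be a compact convex set whose boundary ∂Ω is Lebesgue-negligible, let ν ∈ P(Ω) be absolutely continuous with respect to Lebesgue measure, let ℒ : P(Ω) → ℝ ∪ {+∞} be lower semicontinuous with respect to weak convergence and not identically +∞, and let τ > 0. Then the infimum over Borel measurable maps T : Ω → Ω of ℒ(T_♯ν) + (1/(2τ)) ∫_Ω ‖T(x) − x‖² dν(x) equals the infimum over ρ ∈ P(Ω) of ℒ(ρ) + (1/(2τ)) W₂²(ρ, ν); moreover, the first infimum is attained by a Borel map T* that is an optimal transport map from ν to T*_♯ν, and T*_♯ν minimizes ρ ↦ ℒ(ρ) + (1/(2τ)) W₂²(ρ, ν) over P(Ω). -/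
open MeasureTheory Filter Topology Set

/-- A compact monotone relation is single-valued outside of a null set. -/
lemma exists_null_forall_notMem_eq_of_monotone {E : Type*} [NormedAddCommGroup E]
    [InnerProductSpace ℝ E] [FiniteDimensional ℝ E] [MeasurableSpace E] [BorelSpace E]
    (μ : Measure E) [μ.IsAddHaarMeasure] {Γ : Set (E × E)} (hΓ : IsCompact Γ)
    (hmono : ∀ p ∈ Γ, ∀ q ∈ Γ, 0 ≤ inner ℝ (p.1 - q.1) (p.2 - q.2)) :
    ∃ N : Set E, μ N = 0 ∧
      ∀ y ∉ N, ∀ x₀ x₁, (x₀, y) ∈ Γ → (x₁, y) ∈ Γ → x₀ = x₁ := by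
  have : Nonempty E := ⟨0⟩
  let A : ℕ × ℕ → Set E := fun k =>
    Prod.snd '' (Γ ∩ (Metric.closedBall (TopologicalSpace.denseSeq E k.1) (1 / ((k.2 : ℝ) + 1)) ×ˢ
      univ))
  have hA : ∀ k, MeasurableSet (A k) := fun k =>
    ((hΓ.inter_right (Metric.isClosed_closedBall.prod isClosed_univ)).image
      continuous_snd).measurableSet
  have hdens := fun k => Besicovitch.ae_tendsto_measure_inter_div_of_measurableSet μ (hA k)
  rw [← ae_all_iff] at hdens
  refine ⟨_, hdens, fun y hy x₀ x₁ h₀ h₁ => ?_⟩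
  simp only [mem_compl_iff, mem_ofPred_eq, not_not] at hy
  by_contra hne
  set v := x₁ - x₀ with hv
  have hvpos : 0 < ‖v‖ := norm_pos_iff.2 (sub_ne_zero.2 (Ne.symm hne))
  obtain ⟨m, hm⟩ := exists_nat_one_div_lt (show 0 < ‖v‖ / 4 by positivity)
  obtain ⟨n, hn⟩ := (TopologicalSpace.denseRange_denseSeq E).exists_dist_lt x₀
    (Nat.one_div_pos_of_nat (α := ℝ) (n := m))
  have hyA : y ∈ A (n, m) := ⟨(x₀, y), ⟨h₀, ⟨hn.le, mem_univ _⟩⟩, rfl⟩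
  have hlim := hy (n, m)
  rw [indicator_of_mem hyA, Pi.one_apply] at hlim
  have hne := Measure.eventually_nonempty_inter_smul_of_density_one μ _ y hlim
    (Metric.ball v (‖v‖ / 4)) measurableSet_ball
    (Metric.measure_ball_pos μ v (by positivity)).ne'
  obtain ⟨r, ⟨y', hy'A, hy'⟩, hr⟩ := (hne.and self_mem_nhdsWithin).exists
  obtain ⟨⟨x', _⟩, ⟨hxΓ, hxball, -⟩, rfl⟩ := hy'A
  obtain ⟨_, rfl, _, ⟨w, hw, rfl⟩, hyw⟩ := hy'
  simp only at hyw hxball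
  have hmon := hmono _ hxΓ _ h₁
  simp only [← hyw, add_sub_cancel_left, inner_smul_right] at hmon
  have hmon' : 0 ≤ inner ℝ (x' - x₁) w := nonneg_of_mul_nonneg_right hmon hr
  have hx'x₀ : ‖x' - x₀‖ ≤ ‖v‖ / 2 := by
    have := dist_triangle_right x' x₀ (TopologicalSpace.denseSeq E n)
    rw [← dist_eq_norm]
    have h2 := Metric.mem_closedBall.1 hxball
    linarith
  have hwv : ‖w - v‖ ≤ ‖v‖ / 4 := by
    rw [← dist_eq_norm]; exact (Metric.mem_ball.1 hw).le
  have hexp : inner ℝ (x' - x₁) w = inner ℝ (x' - x₀) v + inner ℝ (x' - x₀) (w - v)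
      - inner ℝ v v - inner ℝ v (w - v) := by
    rw [show x' - x₁ = (x' - x₀) - v by rw [hv]; abel]
    simp only [inner_sub_left, inner_sub_right]; ring
  have i₁ := real_inner_le_norm (x' - x₀) v
  have i₂ := real_inner_le_norm (x' - x₀) (w - v)
  have i₃ := neg_le_of_abs_le (abs_real_inner_le_norm v (w - v))
  have i₄ := real_inner_self_eq_norm_sq v
  nlinarith [mul_le_mul_of_nonneg_right hx'x₀ hvpos.le,
    mul_le_mul hx'x₀ hwv (norm_nonneg _) (by positivity),
    mul_le_mul_of_nonneg_left hwv hvpos.le, pow_pos hvpos 2]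

/-- A compact relation that is single-valued outside of a measurable set coincides there with the
graph of a measurable map. -/
lemma exists_measurable_eq_fst_of_isCompact {X Y : Type*} [TopologicalSpace X] [T2Space X]
    [MeasurableSpace X] [BorelSpace X] [TopologicalSpace Y] [T2Space Y] [MeasurableSpace Y]
    [BorelSpace Y] [Nonempty X] {Γ : Set (X × Y)} (hΓ : IsCompact Γ) {N : Set Y}
    (hN : MeasurableSet N)
    (huniq : ∀ y ∉ N, ∀ x₀ x₁, (x₀, y) ∈ Γ → (x₁, y) ∈ Γ → x₀ = x₁) :
    ∃ T : Y → X, Measurable T ∧ ∀ p ∈ Γ, p.2 ∉ N → T p.2 = p.1 := by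
  classical
  let x₀ : X := Classical.arbitrary X
  let D : Set Y := Prod.snd '' Γ \ N
  have hD : MeasurableSet D := (hΓ.image continuous_snd).measurableSet.diff hN
  let T : Y → X := fun y => if h : ∃ x, (x, y) ∈ Γ ∧ y ∉ N then h.choose else x₀
  have hT : ∀ p ∈ Γ, p.2 ∉ N → T p.2 = p.1 := by
    intro p hp hpN
    have h : ∃ x, (x, p.2) ∈ Γ ∧ p.2 ∉ N := ⟨p.1, hp, hpN⟩
    simp only [T, dif_pos h]
    exact huniq _ hpN _ _ h.choose_spec.1 hp
  have hT₀ : ∀ y ∉ D, T y = x₀ := by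
    intro y hy
    refine dif_neg ?_
    rintro ⟨x, hx, hyN⟩
    exact hy ⟨⟨(x, y), hx, rfl⟩, hyN⟩
  refine ⟨T, measurable_of_isClosed fun K hK => ?_, hT⟩
  have hKD : T ⁻¹' K = (Prod.snd '' (Γ ∩ Prod.fst ⁻¹' K) \ N) ∪ (Dᶜ ∩ {_y | x₀ ∈ K}) := by
    ext y
    by_cases hy : y ∈ D
    · obtain ⟨⟨p, hp, rfl⟩, hyN⟩ := hy
      have : p.2 ∈ D := ⟨⟨p, hp, rfl⟩, hyN⟩
      simp only [mem_preimage, hT p hp hyN, mem_union, Set.mem_sdiff, mem_image, mem_inter_iff, hyN,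
        not_false_eq_true, and_true, mem_compl_iff, this, not_true_eq_false, false_and, or_false]
      refine ⟨fun h => ⟨p, ⟨hp, h⟩, rfl⟩, ?_⟩
      rintro ⟨q, ⟨hq, hqK⟩, hqp⟩
      rwa [← huniq p.2 hyN q.1 p.1 (hqp ▸ hq) hp]
    · have : y ∉ Prod.snd '' (Γ ∩ Prod.fst ⁻¹' K) \ N := by
        rintro ⟨⟨p, hp, rfl⟩, hyN⟩
        exact hy ⟨⟨p, hp.1, rfl⟩, hyN⟩
      simp [hT₀ y hy, hy, this]
  rw [hKD]
  exact (((hΓ.inter_right (hK.preimage continuous_fst)).image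
    continuous_snd).measurableSet.diff hN).union (hD.compl.inter (MeasurableSet.const _))

/-- Two-point cyclical monotonicity: any two points in the support of an optimal coupling for a
continuous cost cannot be improved by exchanging their second components. -/
lemma add_le_add_swap_of_mem_support_of_optimal {X Y : Type*} [TopologicalSpace X]
    [CompactSpace X] [SecondCountableTopology X] [MeasurableSpace X] [BorelSpace X]
    [TopologicalSpace Y] [CompactSpace Y] [SecondCountableTopology Y] [MeasurableSpace Y]
    [BorelSpace Y] (γ : Measure (X × Y)) [IsProbabilityMeasure γ] {c : X × Y → ℝ}
    (hc : Continuous c)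
    (hopt : ∀ γ' : Measure (X × Y), IsProbabilityMeasure γ' →
      γ'.map Prod.fst = γ.map Prod.fst → γ'.map Prod.snd = γ.map Prod.snd →
      ∫ p, c p ∂γ ≤ ∫ p, c p ∂γ')
    {p q : X × Y} (hp : p ∈ γ.support) (hq : q ∈ γ.support) :
    c p + c q ≤ c (p.1, q.2) + c (q.1, p.2) := by
  classical
  let W : Set ((X × Y) × (X × Y)) :=
    {z | c (z.1.1, z.2.2) + c (z.2.1, z.1.2) < c z.1 + c z.2}
  have hWo : IsOpen W := isOpen_lt (by fun_prop) (by fun_prop)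
  have hW : MeasurableSet W := hWo.measurableSet
  have hWswap : ∀ z, z.swap ∈ W ↔ z ∈ W := by
    intro z
    simp only [W, mem_ofPred_eq, Prod.fst_swap, Prod.snd_swap]
    rw [add_comm (c z.2), add_comm (c (z.2.1, _))]
  let g : (X × Y) × (X × Y) → X × Y := fun z => if z ∈ W then (z.1.1, z.2.2) else z.1
  have hg : Measurable g := Measurable.ite hW (by fun_prop) (by fun_prop)
  have hint : ∀ {Z : Type _} [MeasurableSpace Z] [TopologicalSpace Z] [CompactSpace Z]
      [OpensMeasurableSpace Z] (m : Measure Z) [IsFiniteMeasure m] (f : Z → ℝ), Continuous f →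
      Integrable f m := fun m _ f hf =>
    hf.integrable_of_hasCompactSupport (HasCompactSupport.of_compactSpace f)
  have hswap : (γ.prod γ).map Prod.swap = γ.prod γ := Measure.prod_swap
  have hfst : ((γ.prod γ).map g).map Prod.fst = γ.map Prod.fst := by
    rw [Measure.map_map measurable_fst hg]
    have : Prod.fst ∘ g = Prod.fst ∘ Prod.fst := by
      ext z; simp only [g, Function.comp]; split_ifs <;> rfl
    rw [this, ← Measure.map_map measurable_fst measurable_fst, ← Measure.fst, ← Measure.fst,
      Measure.fst_prod]
    rfl
  have hsnd : ((γ.prod γ).map g).map Prod.snd = γ.map Prod.snd := by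
    rw [Measure.map_map measurable_snd hg]
    ext B hB
    have hγ : γ.map Prod.snd B = (γ.prod γ) {z | z.1.2 ∈ B} := by
      rw [Measure.map_apply measurable_snd hB]
      conv_lhs => rw [← Measure.fst_prod (μ := γ) (ν := γ)]
      rw [Measure.fst_apply (measurable_snd hB)]
      rfl
    have hB₁ : MeasurableSet {z : (X × Y) × (X × Y) | z.1.2 ∈ B} :=
      (measurable_snd.comp measurable_fst) hB
    have hB₂ : MeasurableSet {z : (X × Y) × (X × Y) | z.2.2 ∈ B} :=
      (measurable_snd.comp measurable_snd) hB
    rw [hγ, Measure.map_apply (measurable_snd.comp hg) hB,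
      ← measure_inter_add_sdiff _ hW, ← measure_inter_add_sdiff {z | z.1.2 ∈ B} hW]
    congr 1
    · rw [← hswap, Measure.map_apply measurable_swap (hB₁.inter hW), hswap]
      congr 1
      ext z
      simp only [mem_inter_iff, mem_preimage, mem_ofPred_eq, hWswap, Prod.fst_swap]
      refine and_congr_left fun hz => ?_
      simp [g, hz]
    · congr 1
      ext z
      simp only [Set.mem_sdiff, mem_preimage, mem_ofPred_eq]
      refine and_congr_left fun hz => ?_
      simp [g, hz]
  have hle := hopt _ (Measure.isProbabilityMeasure_map hg.aemeasurable) hfst hsnd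
  rw [integral_map hg.aemeasurable hc.aestronglyMeasurable] at hle
  let h : (X × Y) × (X × Y) → ℝ := W.indicator fun z => c (z.1.1, z.2.2) - c z.1
  have hcg : ∀ z, c (g z) = h z + c z.1 := by
    intro z
    by_cases hz : z ∈ W <;> simp [g, h, hz]
  have hhint : Integrable h (γ.prod γ) := (hint _ _ (by fun_prop)).indicator hW
  have hc₁ : Integrable (fun z : (X × Y) × (X × Y) => c z.1) (γ.prod γ) :=
    hint _ _ (by fun_prop)
  have hcfst : ∫ z, c z.1 ∂(γ.prod γ) = ∫ p, c p ∂γ := by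
    rw [integral_fun_fst]; simp
  have hhnn : 0 ≤ ∫ z, h z ∂(γ.prod γ) := by
    simp_rw [hcg] at hle
    rw [integral_add hhint hc₁, hcfst] at hle
    linarith
  have hhswap : ∫ z, h z.swap ∂(γ.prod γ) = ∫ z, h z ∂(γ.prod γ) := integral_prod_swap h
  have hsum : ∀ z, -(h z + h z.swap) =
      W.indicator (fun z => c z.1 + c z.2 - (c (z.1.1, z.2.2) + c (z.2.1, z.1.2))) z := by
    intro z
    by_cases hz : z ∈ W
    · simp only [h, indicator_of_mem hz, indicator_of_mem ((hWswap z).2 hz), Prod.fst_swap,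
        Prod.snd_swap]
      ring
    · simp only [h, indicator_of_notMem hz, indicator_of_notMem (mt (hWswap z).1 hz)]
      simp
  have hnn : 0 ≤ fun z => -(h z + h z.swap) := by
    intro z
    rw [Pi.zero_apply]
    beta_reduce
    rw [hsum]
    refine indicator_nonneg (fun z hz => ?_) z
    exact (sub_pos.2 hz).le
  have hzero : ∫ z, -(h z + h z.swap) ∂(γ.prod γ) = 0 := by
    refine le_antisymm ?_ (integral_nonneg hnn)
    have hadd : ∫ z, h z + h z.swap ∂(γ.prod γ) =
        ∫ z, h z ∂(γ.prod γ) + ∫ z, h z.swap ∂(γ.prod γ) :=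
      integral_add hhint hhint.swap
    rw [integral_neg, hadd, hhswap]
    linarith
  have hae := (integral_eq_zero_iff_of_nonneg hnn (hhint.add hhint.swap).neg).1 hzero
  have hWnull : (γ.prod γ) W = 0 := by
    refine measure_mono_null (fun z hz => ?_) hae
    simp only [mem_compl_iff, mem_ofPred_eq, Pi.zero_apply]
    rw [hsum, indicator_of_mem hz]
    exact (sub_pos.2 hz).ne'
  by_contra! hlt
  have hmem : (p, q) ∈ W := hlt
  obtain ⟨U, V, hU, hpU, hV, hqV, hUV⟩ :=
    mem_nhds_prod_iff'.1 (hWo.mem_nhds hmem)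
  have hUpos := (Measure.mem_support_iff_forall p).1 hp U (hU.mem_nhds hpU)
  have hVpos := (Measure.mem_support_iff_forall q).1 hq V (hV.mem_nhds hqV)
  have := measure_mono_null hUV hWnull
  rw [Measure.prod_prod, mul_eq_zero] at this
  exact this.elim hUpos.ne' hVpos.ne'

/-- An optimal coupling for the quadratic cost whose second marginal is absolutely continuous is
carried by the graph of a measurable map. -/
lemma exists_measurable_eq_map_graph_of_optimal {E : Type*} [NormedAddCommGroup E]
    [InnerProductSpace ℝ E] [FiniteDimensional ℝ E] [MeasurableSpace E] [BorelSpace E]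
    (μ : Measure E) [μ.IsAddHaarMeasure] {Ω : Set E} (hΩ : IsCompact Ω)
    (γ : Measure (Ω × Ω)) [IsProbabilityMeasure γ]
    (hac : (γ.map Prod.snd).map Subtype.val ≪ μ)
    (hopt : ∀ γ' : Measure (Ω × Ω), IsProbabilityMeasure γ' →
      γ'.map Prod.fst = γ.map Prod.fst → γ'.map Prod.snd = γ.map Prod.snd →
      ∫ p, ‖(p.1 : E) - (p.2 : E)‖ ^ 2 ∂γ ≤ ∫ p, ‖(p.1 : E) - (p.2 : E)‖ ^ 2 ∂γ') :
    ∃ T : Ω → Ω, Measurable T ∧ (γ.map Prod.snd).map (fun y => (T y, y)) = γ := by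
  have : CompactSpace Ω := isCompact_iff_compactSpace.1 hΩ
  have : Nonempty Ω := (nonempty_of_isProbabilityMeasure γ).map Prod.fst
  have hΓ : IsCompact γ.support := Measure.isClosed_support.isCompact
  have hmono := fun p hp q hq => add_le_add_swap_of_mem_support_of_optimal γ
    (c := fun p => ‖(p.1 : E) - (p.2 : E)‖ ^ 2) (by fun_prop) hopt (p := p) (q := q) hp hq
  obtain ⟨N, hN, huniq⟩ := exists_null_forall_notMem_eq_of_monotone μ
    (Γ := Prod.map Subtype.val Subtype.val '' γ.support) (hΓ.image (by fun_prop)) (by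
      rintro _ ⟨p, hp, rfl⟩ _ ⟨q, hq, rfl⟩
      have h := hmono p hp q hq
      simp only [Prod.map_fst, Prod.map_snd, inner_sub_left, inner_sub_right]
      simp only [norm_sub_sq_real] at h
      linarith)
  obtain ⟨T, hT, hTΓ⟩ := exists_measurable_eq_fst_of_isCompact hΓ
    (N := Subtype.val ⁻¹' toMeasurable μ N)
    (measurable_subtype_coe (measurableSet_toMeasurable μ N))
    (fun y hy x₀ x₁ h₀ h₁ => Subtype.ext <|
      huniq y (fun h => hy (subset_toMeasurable μ N h)) x₀ x₁ ⟨_, h₀, rfl⟩ ⟨_, h₁, rfl⟩)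
  refine ⟨T, hT, ?_⟩
  have hnull : ∀ᵐ p ∂γ, (p.2 : E) ∉ toMeasurable μ N := by
    have h := hac ((measure_toMeasurable N).trans hN)
    rw [Measure.map_map measurable_subtype_coe measurable_snd,
      Measure.map_apply (measurable_subtype_coe.comp measurable_snd)
        (measurableSet_toMeasurable μ N)] at h
    rw [ae_iff]
    simp only [not_not]
    exact h
  rw [Measure.map_map (show Measurable fun y => (T y, y) from hT.prodMk measurable_id)
    measurable_snd]
  conv_rhs => rw [← Measure.map_id (μ := γ)]
  refine Measure.map_congr ?_
  filter_upwards [hnull, Measure.support_mem_ae (μ := γ)] with p hp hpΓ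
  exact Prod.ext (hTΓ p hpΓ hp) rfl

/-- The set of transport costs of couplings of two probability measures is nonempty. -/
lemma nonempty_couplingCost {d : ℕ} {Ω : Set (EuclideanSpace ℝ (Fin d))}
    (α β : ProbabilityMeasure Ω) :
    {c : ℝ | ∃ γ : Measure (Ω × Ω), IsProbabilityMeasure γ ∧
      γ.map Prod.fst = α ∧ γ.map Prod.snd = β ∧
      c = ∫ p, ‖(p.1 : EuclideanSpace ℝ (Fin d)) - (p.2 : EuclideanSpace ℝ (Fin d))‖ ^ 2
        ∂γ}.Nonempty :=
  ⟨_, (α : Measure Ω).prod β, inferInstance, by simp, by simp, rfl⟩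

lemma W2sq_le_integral {d : ℕ} {Ω : Set (EuclideanSpace ℝ (Fin d))} {α β : Measure Ω}
    (γ : Measure (Ω × Ω)) [IsProbabilityMeasure γ] (hα : γ.map Prod.fst = α)
    (hβ : γ.map Prod.snd = β) :
    W2sq α β ≤
      ∫ p, ‖(p.1 : EuclideanSpace ℝ (Fin d)) - (p.2 : EuclideanSpace ℝ (Fin d))‖ ^ 2 ∂γ := by
  refine csInf_le ⟨0, ?_⟩ ⟨γ, inferInstance, hα, hβ, rfl⟩
  rintro _ ⟨γ', -, -, -, rfl⟩
  positivity

lemma W2sq_comm {d : ℕ} {Ω : Set (EuclideanSpace ℝ (Fin d))} (α β : Measure Ω) :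
    W2sq α β = W2sq β α := by
  unfold W2sq
  congr 1
  ext c
  constructor <;>
  · rintro ⟨γ, hγ, h₁, h₂, rfl⟩
    refine ⟨γ.map Prod.swap, Measure.isProbabilityMeasure_map (by fun_prop), ?_, ?_, ?_⟩
    · rwa [Measure.map_map measurable_fst measurable_swap]
    · rwa [Measure.map_map measurable_snd measurable_swap]
    · rw [integral_map (by fun_prop)
        (Continuous.aestronglyMeasurable (by fun_prop))]
      simp only [Prod.fst_swap, Prod.snd_swap]
      simp_rw [norm_sub_rev]

/-- The cost of the coupling induced by a measurable map `T` is the transport cost of `T`. -/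
lemma integral_map_graph {d : ℕ} {Ω : Set (EuclideanSpace ℝ (Fin d))} (ν : Measure Ω)
    {T : Ω → Ω} (hT : Measurable T) :
    ∫ p, ‖(p.1 : EuclideanSpace ℝ (Fin d)) - (p.2 : EuclideanSpace ℝ (Fin d))‖ ^ 2
        ∂(ν.map fun y => (T y, y)) =
      ∫ x, ‖(T x : EuclideanSpace ℝ (Fin d)) - (x : EuclideanSpace ℝ (Fin d))‖ ^ 2 ∂ν :=
  integral_map (hT.prodMk measurable_id).aemeasurable
    (Continuous.aestronglyMeasurable (by fun_prop))

lemma W2sq_map_le {d : ℕ} {Ω : Set (EuclideanSpace ℝ (Fin d))} (ν : Measure Ω)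
    [IsProbabilityMeasure ν] {T : Ω → Ω} (hT : Measurable T) :
    W2sq (ν.map T) ν ≤
      ∫ x, ‖(T x : EuclideanSpace ℝ (Fin d)) - (x : EuclideanSpace ℝ (Fin d))‖ ^ 2 ∂ν := by
  have hg : Measurable fun y => (T y, y) := hT.prodMk measurable_id
  have := Measure.isProbabilityMeasure_map (μ := ν) hg.aemeasurable
  rw [← integral_map_graph ν hT]
  refine W2sq_le_integral _ ?_ ?_
  · rw [Measure.map_map measurable_fst hg]; rfl
  · rw [Measure.map_map measurable_snd hg]; exact Measure.map_id

/-- The minimizing movement functional attains its minimum over couplings with prescribed second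
marginal. -/
lemma exists_optimal_coupling {X Y : Type*} [TopologicalSpace X] [CompactSpace X]
    [TopologicalSpace.MetrizableSpace X] [MeasurableSpace X] [BorelSpace X] [TopologicalSpace Y]
    [CompactSpace Y] [TopologicalSpace.MetrizableSpace Y] [MeasurableSpace Y] [BorelSpace Y]
    [Nonempty X] (ν : ProbabilityMeasure Y) {L : ProbabilityMeasure X → EReal}
    (hL : LowerSemicontinuous L) {c : X × Y → ℝ} (hc : Continuous c) (K : ℝ) :
    ∃ γ : ProbabilityMeasure (X × Y), γ.map measurable_snd.aemeasurable = ν ∧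
      ∀ γ' : ProbabilityMeasure (X × Y), γ'.map measurable_snd.aemeasurable = ν →
        L (γ.map measurable_fst.aemeasurable) + ((K * ∫ p, c p ∂(γ : Measure (X × Y)) : ℝ) : EReal)
          ≤ L (γ'.map measurable_fst.aemeasurable) +
            ((K * ∫ p, c p ∂(γ' : Measure (X × Y)) : ℝ) : EReal) := by
  have hS : IsClosed {γ : ProbabilityMeasure (X × Y) | γ.map measurable_snd.aemeasurable = ν} :=
    isClosed_eq (ProbabilityMeasure.continuous_map continuous_snd) continuous_const
  have hne : {γ : ProbabilityMeasure (X × Y) | γ.map measurable_snd.aemeasurable = ν}.Nonempty := by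
    refine ⟨⟨(Measure.dirac (Classical.arbitrary X)).prod ν, inferInstance⟩, ?_⟩
    apply Subtype.ext
    simp [ProbabilityMeasure.map]
  have hint : Continuous fun γ : ProbabilityMeasure (X × Y) =>
      ((K * ∫ p, c p ∂(γ : Measure (X × Y)) : ℝ) : EReal) :=
    continuous_coe_real_ereal.comp (continuous_const.mul
      (ProbabilityMeasure.continuous_integral_continuousMap (⟨c, hc⟩ : C(X × Y, ℝ))))
  have hlsc := (hL.comp (ProbabilityMeasure.continuous_map
    (continuous_fst (X := X) (Y := Y)))).add' hint.lowerSemicontinuous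
    (fun γ => EReal.continuousAt_add (.inr (EReal.coe_ne_bot _)) (.inr (EReal.coe_ne_top _)))
  obtain ⟨γ, hγ, hmin⟩ := hlsc.lowerSemicontinuousOn _ |>.exists_isMinOn hne hS.isCompact
  exact ⟨γ, hγ, fun γ' hγ' => hmin hγ'⟩

/-- The map-valued minimizing movement problem
`T ↦ ℒ(T_♯ν) + (1/(2τ)) ∫ ‖T(x) - x‖² dν` has the same infimum as the measure-valued problem
`ρ ↦ ℒ(ρ) + (1/(2τ)) W₂²(ρ, ν)`; the first infimum is attained by a Borel map `T*` that is an
optimal transport map from `ν` to `T*_♯ν`, and `T*_♯ν` minimizes the measure-valued problem. -/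
theorem map_valued_minimizing_movement_step
    {d : ℕ} (hd : 1 ≤ d) (Ω : Set (EuclideanSpace ℝ (Fin d)))
    (hΩcompact : IsCompact Ω) (hΩconvex : Convex ℝ Ω)
    (hΩboundary : volume (frontier Ω) = 0)
    (ν : ProbabilityMeasure Ω)
    (hνac : (ν : Measure Ω).map Subtype.val ≪ (volume : Measure (EuclideanSpace ℝ (Fin d))))
    (L : ProbabilityMeasure Ω → EReal)
    (hLlsc : LowerSemicontinuous L)
    (hLnotbot : ∀ ρ, L ρ ≠ ⊥)
    (hLproper : ∃ ρ, L ρ ≠ ⊤)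
    (τ : ℝ) (hτ : 0 < τ) :
    ((⨅ T : {T : Ω → Ω // Measurable T},
        L (ν.map T.2.aemeasurable) +
          ((1 / (2 * τ) * ∫ x, ‖(T.1 x : EuclideanSpace ℝ (Fin d)) -
            (x : EuclideanSpace ℝ (Fin d))‖ ^ 2 ∂(ν : Measure Ω) : ℝ) : EReal))
      = ⨅ ρ : ProbabilityMeasure Ω,
          L ρ + ((1 / (2 * τ) * W2sq (ρ : Measure Ω) (ν : Measure Ω) : ℝ) : EReal))
    ∧ ∃ (Tstar : Ω → Ω) (hTstar : Measurable Tstar),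
        (∀ (T : Ω → Ω) (hT : Measurable T),
          L (ν.map hTstar.aemeasurable) +
            ((1 / (2 * τ) * ∫ x, ‖(Tstar x : EuclideanSpace ℝ (Fin d)) -
              (x : EuclideanSpace ℝ (Fin d))‖ ^ 2 ∂(ν : Measure Ω) : ℝ) : EReal)
          ≤ L (ν.map hT.aemeasurable) +
            ((1 / (2 * τ) * ∫ x, ‖(T x : EuclideanSpace ℝ (Fin d)) -
              (x : EuclideanSpace ℝ (Fin d))‖ ^ 2 ∂(ν : Measure Ω) : ℝ) : EReal)) ∧
        IsOptimalTransportMap Tstar (ν : Measure Ω) ((ν : Measure Ω).map Tstar) ∧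
        (∀ ρ : ProbabilityMeasure Ω,
          L (ν.map hTstar.aemeasurable) +
            ((1 / (2 * τ) * W2sq ((ν.map hTstar.aemeasurable : ProbabilityMeasure Ω) : Measure Ω)
              (ν : Measure Ω) : ℝ) : EReal)
          ≤ L ρ + ((1 / (2 * τ) * W2sq (ρ : Measure Ω) (ν : Measure Ω) : ℝ) : EReal)) := by
  have hcomp : CompactSpace Ω := isCompact_iff_compactSpace.1 hΩcompact
  have hnonempty : Nonempty Ω := nonempty_of_isProbabilityMeasure (ν : Measure Ω)
  have hK : 0 < 1 / (2 * τ) := by positivity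
  set K := 1 / (2 * τ)
  obtain ⟨γ, hγν, hγmin⟩ := exists_optimal_coupling ν hLlsc
    (c := fun p : Ω × Ω =>
      ‖(p.1 : EuclideanSpace ℝ (Fin d)) - (p.2 : EuclideanSpace ℝ (Fin d))‖ ^ 2) (by fun_prop) K
  have hγν' : (γ : Measure (Ω × Ω)).map Prod.snd = ν := congrArg Subtype.val hγν
  have hLfin : L (γ.map measurable_fst.aemeasurable) ≠ ⊤ := by
    obtain ⟨ρ, hρ⟩ := hLproper
    intro htop
    have h := hγmin (ρ.prod ν) (Subtype.ext (by simp [ProbabilityMeasure.map]))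
    have hfst : (ρ.prod ν).map measurable_fst.aemeasurable = ρ :=
      Subtype.ext (by simp [ProbabilityMeasure.map])
    rw [htop, EReal.top_add_coe, hfst, top_le_iff] at h
    exact EReal.add_ne_top hρ (EReal.coe_ne_top _) h
  have hcancel : ∀ {a : EReal} {b c : ℝ}, a ≠ ⊤ → a ≠ ⊥ →
      a + ((K * b : ℝ) : EReal) ≤ a + ((K * c : ℝ) : EReal) → b ≤ c := by
    intro a b c hat hab h
    lift a to ℝ using ⟨hat, hab⟩
    rw [← EReal.coe_add, ← EReal.coe_add, EReal.coe_le_coe_iff] at h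
    exact le_of_mul_le_mul_left (by linarith) hK
  obtain ⟨T, hT, hTγ⟩ := exists_measurable_eq_map_graph_of_optimal volume hΩcompact
    (γ : Measure (Ω × Ω)) (by rwa [hγν']) (fun γ' hγ' h₁ h₂ => by
      have h := hγmin ⟨γ', hγ'⟩ (Subtype.ext (h₂.trans hγν'))
      have hfst : ProbabilityMeasure.map ⟨γ', hγ'⟩ measurable_fst.aemeasurable =
        γ.map measurable_fst.aemeasurable := Subtype.ext h₁
      rw [hfst] at h
      exact hcancel hLfin (hLnotbot _) h)
  rw [hγν'] at hTγ
  have hTfst : γ.map measurable_fst.aemeasurable = ν.map hT.aemeasurable := by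
    refine Subtype.ext ?_
    change (γ : Measure (Ω × Ω)).map Prod.fst = (ν : Measure Ω).map T
    rw [← hTγ, Measure.map_map measurable_fst
      (show Measurable fun y => (T y, y) from hT.prodMk measurable_id)]
    rfl
  rw [hTfst] at hLfin hγmin
  rw [← hTγ, integral_map_graph _ hT] at hγmin
  have hmeas : ∀ ρ : ProbabilityMeasure Ω,
      L (ν.map hT.aemeasurable) +
        ((K * ∫ x, ‖(T x : EuclideanSpace ℝ (Fin d)) -
          (x : EuclideanSpace ℝ (Fin d))‖ ^ 2 ∂(ν : Measure Ω) : ℝ) : EReal)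
      ≤ L ρ + ((K * W2sq (ρ : Measure Ω) (ν : Measure Ω) : ℝ) : EReal) := by
    intro ρ
    by_cases hρ : L ρ = ⊤
    · rw [hρ, EReal.top_add_coe]; exact le_top
    have hcoupling : ∀ γ' : Measure (Ω × Ω), IsProbabilityMeasure γ' → γ'.map Prod.fst = ρ →
        γ'.map Prod.snd = ν →
        L (ν.map hT.aemeasurable) + ((K * ∫ x, ‖(T x : EuclideanSpace ℝ (Fin d)) -
          (x : EuclideanSpace ℝ (Fin d))‖ ^ 2 ∂(ν : Measure Ω) : ℝ) : EReal) ≤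
        L ρ + ((K * ∫ p, ‖(p.1 : EuclideanSpace ℝ (Fin d)) -
          (p.2 : EuclideanSpace ℝ (Fin d))‖ ^ 2 ∂γ' : ℝ) : EReal) := by
      intro γ' hγ' h₁ h₂
      have h := hγmin ⟨γ', hγ'⟩ (Subtype.ext h₂)
      have hfst : ProbabilityMeasure.map ⟨γ', hγ'⟩ measurable_fst.aemeasurable = ρ :=
        Subtype.ext h₁
      rwa [hfst] at h
    have hρbot := hLnotbot ρ
    have hTbot := hLnotbot (ν.map hT.aemeasurable)
    generalize L ρ = a at *
    generalize L (ν.map hT.aemeasurable) = b at *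
    lift a to ℝ using ⟨hρ, hρbot⟩
    lift b to ℝ using ⟨hLfin, hTbot⟩
    simp only [← EReal.coe_add, EReal.coe_le_coe_iff] at hcoupling ⊢
    rw [← sub_le_iff_le_add', ← div_le_iff₀' hK]
    refine le_csInf (nonempty_couplingCost ρ ν) ?_
    rintro _ ⟨γ', hγ', h₁, h₂, rfl⟩
    rw [div_le_iff₀' hK, sub_le_iff_le_add']
    exact hcoupling γ' hγ' h₁ h₂
  have hmap : ∀ (S : Ω → Ω) (hS : Measurable S),
      L (ν.map hS.aemeasurable) + ((K * W2sq ((ν.map hS.aemeasurable : ProbabilityMeasure Ω) :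
        Measure Ω) (ν : Measure Ω) : ℝ) : EReal)
      ≤ L (ν.map hS.aemeasurable) + ((K * ∫ x, ‖(S x : EuclideanSpace ℝ (Fin d)) -
          (x : EuclideanSpace ℝ (Fin d))‖ ^ 2 ∂(ν : Measure Ω) : ℝ) : EReal) := fun S hS =>
    add_le_add_right (EReal.coe_le_coe_iff.2
      (mul_le_mul_of_nonneg_left (W2sq_map_le _ hS) hK.le)) _
  refine ⟨le_antisymm (le_iInf fun ρ => (iInf_le _ ⟨T, hT⟩).trans (hmeas ρ))
    (le_iInf fun S => (iInf_le _ (ν.map S.2.aemeasurable)).trans (hmap S.1 S.2)),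
    T, hT, fun S hS => (hmeas _).trans (hmap S hS), ⟨hT, rfl, ?_⟩,
    fun ρ => (hmap T hT).trans (hmeas ρ)⟩
  rw [W2sq_comm]
  exact le_antisymm (hcancel hLfin (hLnotbot _) (hmeas (ν.map hT.aemeasurable)))
    (W2sq_map_le _ hT)
end

section
/- Let d ≥ 1, let Ω ⊂ ℝ^d be a compact convex set whose boundary ∂Ω is Lebesgue-negligible, let ν ∈ P(Ω) be absolutely continuous with respect to Lebesgue measure, let ℒ : P(Ω) → ℝ ∪ {+∞} be lower semicontinuous with respect to weak convergence and not identically +∞, and let τ > 0. Suppose ρ* ∈ P(Ω) minimizes ρ ↦ ℒ(ρ) + (1/(2τ)) W₂²(ρ, ν) over P(Ω). Then there exists an optimal transport map T from ν to ρ*, and any such T minimizes the map-valued problem T ↦ ℒ(T_♯ν) + (1/(2τ)) W₂²(T_♯ν, ν) over all Borel measurable maps from Ω to Ω. -/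
open MeasureTheory Filter Topology Set

/-- A positive linear functional on `C(X, ℝ)`, with `X` compact, is integration against a finite
measure. -/
theorem exists_measure_integral_eq_of_nonneg {X : Type*} [TopologicalSpace X] [CompactSpace X]
    [T2Space X] [MeasurableSpace X] [BorelSpace X] (Λ : C(X, ℝ) →ₗ[ℝ] ℝ)
    (hΛ : ∀ f, 0 ≤ f → 0 ≤ Λ f) :
    ∃ γ : Measure X, IsFiniteMeasure γ ∧ ∀ f : C(X, ℝ), ∫ x, f x ∂γ = Λ f := by
  let Λ₀ : CompactlySupportedContinuousMap X ℝ →ₗ[ℝ] ℝ :=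
    { toFun := fun f => Λ f.toContinuousMap
      map_add' := fun f g => Λ.map_add f.toContinuousMap g.toContinuousMap
      map_smul' := fun c f => Λ.map_smul c f.toContinuousMap }
  let Λc : CompactlySupportedContinuousMap X ℝ →ₚ[ℝ] ℝ :=
    PositiveLinearMap.mk₀ Λ₀ (fun f hf => hΛ _ hf)
  refine ⟨RealRMK.rieszMeasure Λc, inferInstance, fun f => ?_⟩
  exact RealRMK.integral_rieszMeasure Λc (CompactlySupportedContinuousMap.continuousMapEquiv f)

/-- A sublinear functional on a real vector space is attained at any prescribed vector by a linear
functional it dominates. -/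
theorem exists_linearMap_le_sublinear_eq {E : Type*} [AddCommGroup E] [Module ℝ E] (N : E → ℝ)
    (N_hom : ∀ c : ℝ, 0 < c → ∀ x, N (c • x) = c * N x)
    (N_add : ∀ x y, N (x + y) ≤ N x + N y) (x₀ : E) :
    ∃ Λ : E →ₗ[ℝ] ℝ, Λ x₀ = N x₀ ∧ ∀ x, Λ x ≤ N x := by
  have N_zero : N 0 = 0 := by
    have := N_hom 2 two_pos 0
    rw [smul_zero] at this
    linarith
  have N_neg : ∀ x, -N x ≤ N (-x) := fun x => by
    have := N_add x (-x)
    rw [add_neg_cancel, N_zero] at this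
    linarith
  have H : ∀ c : ℝ, c • x₀ = 0 → (RingHom.id ℝ) c • N x₀ = 0 := by
    intro c hc
    rcases smul_eq_zero.1 hc with rfl | rfl
    · simp
    · simp [N_zero]
  obtain ⟨Λ, hΛ, hle⟩ := exists_extension_of_le_sublinear (LinearPMap.mkSpanSingleton' x₀ (N x₀) H)
    N N_hom N_add (by
      rintro ⟨x, hx⟩
      obtain ⟨c, rfl⟩ := Submodule.mem_span_singleton.1 hx
      rw [LinearPMap.mkSpanSingleton'_apply]
      simp only [RingHom.id_apply, smul_eq_mul]
      rcases lt_trichotomy c 0 with hc | rfl | hc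
      · have h1 := N_hom (-c) (neg_pos.2 hc) (-x₀)
        rw [neg_smul_neg] at h1
        rw [h1]
        nlinarith [N_neg x₀]
      · simp [N_zero]
      · exact (N_hom c hc x₀).ge)
  refine ⟨Λ, ?_, hle⟩
  rw [hΛ ⟨x₀, Submodule.mem_span_singleton_self x₀⟩]
  exact LinearPMap.mkSpanSingleton'_apply_self _ _ _ _

/-- **Kantorovich duality** for a continuous cost on compact spaces: there is a coupling of `μ` and
`ν` whose cost is approximated by that of dual potentials. -/
theorem exists_coupling_forall_exists_dual_lt {X Y : Type*}
    [TopologicalSpace X] [CompactSpace X] [T2Space X] [SecondCountableTopology X]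
    [MeasurableSpace X] [BorelSpace X]
    [TopologicalSpace Y] [CompactSpace Y] [T2Space Y] [SecondCountableTopology Y]
    [MeasurableSpace Y] [BorelSpace Y] [HasOuterApproxClosed X] [HasOuterApproxClosed Y]
    (μ : Measure X) (ν : Measure Y) [IsProbabilityMeasure μ] [IsProbabilityMeasure ν]
    (f₀ : C(X × Y, ℝ)) :
    ∃ γ : Measure (X × Y), IsProbabilityMeasure γ ∧ γ.map Prod.fst = μ ∧ γ.map Prod.snd = ν ∧
      ∀ ε > 0, ∃ (φ : C(X, ℝ)) (ψ : C(Y, ℝ)), (∀ x y, f₀ (x, y) ≤ φ x + ψ y) ∧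
        ∫ x, φ x ∂μ + ∫ y, ψ y ∂ν < ∫ p, f₀ p ∂γ + ε := by
  have intX : ∀ φ : C(X, ℝ), Integrable φ μ := fun φ =>
    φ.continuous.integrable_of_hasCompactSupport (.of_compactSpace _)
  have intY : ∀ φ : C(Y, ℝ), Integrable φ ν := fun φ =>
    φ.continuous.integrable_of_hasCompactSupport (.of_compactSpace _)
  have intXY : ∀ φ : C(X × Y, ℝ), Integrable φ (μ.prod ν) := fun φ =>
    φ.continuous.integrable_of_hasCompactSupport (.of_compactSpace _)
  let A : C(X × Y, ℝ) → Set ℝ := fun f => {c | ∃ (φ : C(X, ℝ)) (ψ : C(Y, ℝ)),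
    (∀ x y, f (x, y) ≤ φ x + ψ y) ∧ c = ∫ x, φ x ∂μ + ∫ y, ψ y ∂ν}
  let N : C(X × Y, ℝ) → ℝ := fun f => sInf (A f)
  have A_ne : ∀ f, (A f).Nonempty := fun f =>
    ⟨_, ContinuousMap.const X ‖f‖, 0, fun x y => by
      simpa using (le_abs_self _).trans (f.norm_coe_le_norm (x, y)), rfl⟩
  have A_bdd : ∀ f, BddBelow (A f) := by
    refine fun f => ⟨∫ p, f p ∂(μ.prod ν), ?_⟩
    rintro c ⟨φ, ψ, h, rfl⟩
    have i1 : Integrable (fun p : X × Y => φ p.1) (μ.prod ν) := (intX φ).comp_fst ν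
    have i2 : Integrable (fun p : X × Y => ψ p.2) (μ.prod ν) := (intY ψ).comp_snd μ
    calc ∫ p, f p ∂(μ.prod ν) ≤ ∫ p : X × Y, (φ p.1 + ψ p.2) ∂(μ.prod ν) :=
          integral_mono (intXY f) (i1.add i2) fun p => h p.1 p.2
      _ = _ := by rw [integral_add i1 i2, integral_fun_fst, integral_fun_snd]; simp
  have N_le : ∀ f (φ : C(X, ℝ)) (ψ : C(Y, ℝ)), (∀ x y, f (x, y) ≤ φ x + ψ y) →
      N f ≤ ∫ x, φ x ∂μ + ∫ y, ψ y ∂ν := fun f φ ψ h => csInf_le (A_bdd f) ⟨φ, ψ, h, rfl⟩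
  have N_lt : ∀ f, ∀ ε > 0, ∃ (φ : C(X, ℝ)) (ψ : C(Y, ℝ)), (∀ x y, f (x, y) ≤ φ x + ψ y) ∧
      ∫ x, φ x ∂μ + ∫ y, ψ y ∂ν < N f + ε := by
    intro f ε hε
    obtain ⟨c, ⟨φ, ψ, h, rfl⟩, hc⟩ := exists_lt_of_csInf_lt (A_ne f) (lt_add_of_pos_right (N f) hε)
    exact ⟨φ, ψ, h, hc⟩
  have N_hom_le : ∀ c : ℝ, 0 < c → ∀ f, N (c • f) ≤ c * N f := by
    intro c hc f
    refine le_of_forall_pos_lt_add fun ε hε => ?_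
    obtain ⟨φ, ψ, h, hlt⟩ := N_lt f (ε / c) (div_pos hε hc)
    refine (N_le (c • f) (c • φ) (c • ψ) fun x y => ?_).trans_lt ?_
    · simpa [mul_add] using mul_le_mul_of_nonneg_left (h x y) hc.le
    · simp only [ContinuousMap.smul_apply, smul_eq_mul, integral_const_mul]
      have := mul_lt_mul_of_pos_left hlt hc
      rw [mul_add, mul_add, mul_div_cancel₀ _ hc.ne'] at this
      exact this
  have N_hom : ∀ c : ℝ, 0 < c → ∀ f, N (c • f) = c * N f := by
    refine fun c hc f => (N_hom_le c hc f).antisymm ?_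
    have := mul_le_mul_of_nonneg_left (N_hom_le c⁻¹ (inv_pos.2 hc) (c • f)) hc.le
    rwa [inv_smul_smul₀ hc.ne', mul_inv_cancel_left₀ hc.ne'] at this
  have N_add : ∀ f g, N (f + g) ≤ N f + N g := by
    intro f g
    refine le_of_forall_pos_lt_add fun ε hε => ?_
    obtain ⟨φ, ψ, h, hlt⟩ := N_lt f (ε / 2) (half_pos hε)
    obtain ⟨φ', ψ', h', hlt'⟩ := N_lt g (ε / 2) (half_pos hε)
    refine (N_le (f + g) (φ + φ') (ψ + ψ') fun x y => ?_).trans_lt ?_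
    · simp only [ContinuousMap.add_apply]
      linarith [h x y, h' x y]
    · simp only [ContinuousMap.add_apply]
      rw [integral_add (intX φ) (intX φ'), integral_add (intY ψ) (intY ψ')]
      linarith
  obtain ⟨Λ, hΛ₀, hΛ⟩ := exists_linearMap_le_sublinear_eq N N_hom N_add f₀
  obtain ⟨γ, hγ, hγΛ⟩ := exists_measure_integral_eq_of_nonneg Λ (by
    intro f hf
    have h1 := (hΛ (-f)).trans (N_le (-f) 0 0 fun x y => by simpa using hf (x, y))
    simpa using h1)
  have eq_of_le : ∀ (Φ : C(X × Y, ℝ)) (a : ℝ), Λ Φ ≤ a → Λ (-Φ) ≤ -a → ∫ p, Φ p ∂γ = a := by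
    intro Φ a h1 h2
    rw [map_neg] at h2
    rw [hγΛ]
    linarith
  have hfst : γ.map Prod.fst = μ := by
    have := Measure.isFiniteMeasure_map γ (Prod.fst : X × Y → X)
    refine ext_of_forall_integral_eq_of_IsFiniteMeasure fun φ => ?_
    rw [integral_map measurable_fst.aemeasurable
      φ.continuous.measurable.stronglyMeasurable.aestronglyMeasurable]
    refine eq_of_le (φ.toContinuousMap.comp ContinuousMap.fst) _
      ((hΛ _).trans ((N_le _ φ.toContinuousMap 0 fun x y => ?_).trans ?_))
      ((hΛ _).trans ((N_le _ (-φ.toContinuousMap) 0 fun x y => ?_).trans ?_)) <;>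
    simp [integral_neg]
  have hsnd : γ.map Prod.snd = ν := by
    have := Measure.isFiniteMeasure_map γ (Prod.snd : X × Y → Y)
    refine ext_of_forall_integral_eq_of_IsFiniteMeasure fun φ => ?_
    rw [integral_map measurable_snd.aemeasurable
      φ.continuous.measurable.stronglyMeasurable.aestronglyMeasurable]
    refine eq_of_le (φ.toContinuousMap.comp ContinuousMap.snd) _
      ((hΛ _).trans ((N_le _ 0 φ.toContinuousMap fun x y => ?_).trans ?_))
      ((hΛ _).trans ((N_le _ 0 (-φ.toContinuousMap) fun x y => ?_).trans ?_)) <;>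
    simp [integral_neg]
  refine ⟨γ, ⟨?_⟩, hfst, hsnd, fun ε hε => ?_⟩
  · have : (γ.map Prod.fst) univ = 1 := by rw [hfst]; exact measure_univ
    rwa [Measure.map_apply measurable_fst .univ, preimage_univ] at this
  · rw [hγΛ, hΛ₀]
    exact N_lt f₀ ε hε

/-- If `φₖ ⊕ ψₖ` dominates the inner product on `K × K`, then some Lipschitz function has `y` as a
subgradient at `x` for all `(x, y) ∈ K × K` at which the gap of this inequality tends to zero. -/
theorem exists_lipschitzWith_subgradient_of_tendsto {E : Type*} [NormedAddCommGroup E]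
    [InnerProductSpace ℝ E] {K : Set E} (hK : IsCompact K) (φ ψ : ℕ → C(K, ℝ))
    (h : ∀ k (x y : K), inner ℝ (x : E) (y : E) ≤ φ k x + ψ k y) :
    ∃ (C : NNReal) (u : E → ℝ), LipschitzWith C u ∧ ∀ x y : K,
      Tendsto (fun k => φ k x + ψ k y - inner ℝ (x : E) (y : E)) atTop (𝓝 0) →
      ∀ z : E, u x + inner ℝ (z - x) (y : E) ≤ u z := by
  rcases K.eq_empty_or_nonempty with rfl | hne
  · exact ⟨0, fun _ => 0, LipschitzWith.const 0, fun x => x.2.elim⟩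
  have : Nonempty K := hne.to_subtype
  have : CompactSpace K := isCompact_iff_compactSpace.1 hK
  obtain ⟨R, hR₀, hR⟩ := hK.isBounded.exists_pos_norm_le
  lift R to NNReal using hR₀.le
  let v : ℕ → E → ℝ := fun k z => ⨆ y : K, (inner ℝ z (y : E) - ψ k y)
  have v_bdd : ∀ k z, BddAbove (range fun y : K => inner ℝ z (y : E) - ψ k y) := fun k z =>
    (isCompact_range (by fun_prop)).bddAbove
  have v_ge : ∀ k z (y : K), inner ℝ z (y : E) - ψ k y ≤ v k z := fun k z y =>
    le_ciSup (v_bdd k z) y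
  have v_le : ∀ k (x : K), v k x ≤ φ k x := fun k x => ciSup_le fun y => by linarith [h k x y]
  have v_lip : ∀ k z w, v k z ≤ v k w + R * dist z w := by
    refine fun k z w => ciSup_le fun y => ?_
    have h1 := v_ge k w y
    have h2 : inner ℝ (z - w) (y : E) ≤ R * dist z w := by
      rw [dist_eq_norm, mul_comm]
      exact (real_inner_le_norm _ _).trans
        (mul_le_mul_of_nonneg_left (hR _ y.2) (norm_nonneg _))
    rw [inner_sub_left] at h2
    linarith
  have hlim : ∀ z, ∃ a, Tendsto (fun k => v k z - v k 0) (hyperfilter ℕ) (𝓝 a) := by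
    intro z
    obtain ⟨a, -, ha⟩ := (isCompact_Icc (a := -(R * dist z 0)) (b := R * dist z 0))
      |>.ultrafilter_le_nhds ((hyperfilter ℕ).map fun k => v k z - v k 0) (by
        rw [le_principal_iff, Ultrafilter.coe_map, mem_map]
        refine Eventually.of_forall fun k => ⟨?_, ?_⟩
        · have := v_lip k 0 z
          rw [dist_comm] at this
          linarith
        · linarith [v_lip k z 0])
    exact ⟨a, ha⟩
  choose u hu using hlim
  refine ⟨R, u, LipschitzWith.of_le_add_mul R fun z w => ?_, fun x y hxy z => ?_⟩
  · exact le_of_tendsto_of_tendsto' (hu z) ((hu w).add_const _) fun k => by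
      linarith [v_lip k z w]
  · have hgap := hxy.mono_left (Nat.hyperfilter_le_atTop)
    have h1 := ((hu x).add_const (inner ℝ (z - x) (y : E))).sub hgap
    rw [sub_zero] at h1
    refine le_of_tendsto_of_tendsto' h1 (hu z) fun k => ?_
    have h2 := v_ge k z y
    have h3 := v_le k x
    rw [inner_sub_left]
    linarith

/-- At a point of differentiability, the only subgradient is the gradient. -/
theorem eq_gradient_of_subgradient {E : Type*} [NormedAddCommGroup E]
    [InnerProductSpace ℝ E] [CompleteSpace E] {u : E → ℝ} {x y : E}
    (hu : DifferentiableAt ℝ u x) (h : ∀ z, u x + inner ℝ (z - x) y ≤ u z) :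
    y = gradient u x := by
  have hd : HasFDerivAt (fun z => u z - innerSL ℝ y z) (fderiv ℝ u x - innerSL ℝ y) x :=
    hu.hasFDerivAt.sub (innerSL ℝ y).hasFDerivAt
  have hmin : IsLocalMin (fun z => u z - innerSL ℝ y z) x := Eventually.of_forall fun z => by
    have := h z
    simp only [inner_sub_left, innerSL_apply_apply] at this ⊢
    rw [real_inner_comm z y, real_inner_comm x y]
    linarith
  have := sub_eq_zero.1 (hmin.hasFDerivAt_eq_zero hd)
  rw [gradient, this, LinearIsometryEquiv.eq_symm_apply]
  ext z
  simp

/-- Nonnegative functions whose integrals are bounded by a summable sequence tend to zero almost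
everywhere. -/
theorem ae_tendsto_zero_of_integral_le {α : Type*} [MeasurableSpace α] {μ : Measure α}
    {g : ℕ → α → ℝ} {a : ℕ → ℝ} (hg : ∀ k, Integrable (g k) μ) (h₀ : ∀ k x, 0 ≤ g k x)
    (ha : Summable a) (hle : ∀ k, ∫ x, g k x ∂μ ≤ a k) :
    ∀ᵐ x ∂μ, Tendsto (fun k => g k x) atTop (𝓝 0) := by
  have hfin : ∫⁻ x, ∑' k, ENNReal.ofReal (g k x) ∂μ ≠ ⊤ := by
    rw [lintegral_tsum fun k => (hg k).aemeasurable.ennreal_ofReal]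
    refine ne_top_of_le_ne_top ha.tsum_ofReal_ne_top (ENNReal.tsum_le_tsum fun k => ?_)
    rw [← ofReal_integral_eq_lintegral_ofReal (hg k) (Eventually.of_forall (h₀ k))]
    exact ENNReal.ofReal_le_ofReal (hle k)
  filter_upwards [ae_lt_top' (AEMeasurable.tsum
    fun k => (hg k).aemeasurable.ennreal_ofReal) hfin] with x hx
  have := (ENNReal.tendsto_toReal ENNReal.zero_ne_top).comp
    (ENNReal.tendsto_atTop_zero_of_tsum_ne_top hx.ne)
  simpa [Function.comp_def, ENNReal.toReal_ofReal (h₀ _ x)] using this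

/-- **Brenier's theorem** on a compact set: an absolutely continuous probability measure admits an
optimal transport map to any other probability measure. -/
theorem exists_isOptimalTransportMap {d : ℕ} {Ω : Set (EuclideanSpace ℝ (Fin d))}
    (hΩ : IsCompact Ω) (μ ν : Measure Ω) [IsProbabilityMeasure μ] [IsProbabilityMeasure ν]
    (hμ : μ.map Subtype.val ≪ (volume : Measure (EuclideanSpace ℝ (Fin d)))) :
    ∃ T : Ω → Ω, IsOptimalTransportMap T μ ν := by
  have : CompactSpace Ω := isCompact_iff_compactSpace.1 hΩ
  obtain ⟨x₀⟩ : Nonempty Ω := nonempty_of_isProbabilityMeasure μ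
  let f₀ : C(Ω × Ω, ℝ) :=
    ⟨fun p => inner ℝ (p.1 : EuclideanSpace ℝ (Fin d)) (p.2 : EuclideanSpace ℝ (Fin d)),
      by fun_prop⟩
  obtain ⟨γ, hγ, hfst, hsnd, hdual⟩ := exists_coupling_forall_exists_dual_lt μ ν f₀
  have int_of_cont : ∀ (γ' : Measure (Ω × Ω)) [IsProbabilityMeasure γ'] {f : Ω × Ω → ℝ},
      Continuous f → Integrable f γ' := fun γ' _ f hf =>
    hf.integrable_of_hasCompactSupport (.of_compactSpace _)
  have integral_fst : ∀ (γ' : Measure (Ω × Ω)), γ'.map Prod.fst = μ → ∀ φ : Ω → ℝ, Continuous φ →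
      ∫ p, φ p.1 ∂γ' = ∫ x, φ x ∂μ := by
    rintro γ' h φ hφ
    rw [← h, integral_map measurable_fst.aemeasurable
      hφ.measurable.stronglyMeasurable.aestronglyMeasurable]
  have integral_snd : ∀ (γ' : Measure (Ω × Ω)), γ'.map Prod.snd = ν → ∀ φ : Ω → ℝ, Continuous φ →
      ∫ p, φ p.2 ∂γ' = ∫ x, φ x ∂ν := by
    rintro γ' h φ hφ
    rw [← h, integral_map measurable_snd.aemeasurable
      hφ.measurable.stronglyMeasurable.aestronglyMeasurable]
  have integral_sum : ∀ (γ' : Measure (Ω × Ω)) [IsProbabilityMeasure γ'], γ'.map Prod.fst = μ →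
      γ'.map Prod.snd = ν → ∀ φ ψ : C(Ω, ℝ),
      ∫ p, (φ p.1 + ψ p.2) ∂γ' = ∫ x, φ x ∂μ + ∫ y, ψ y ∂ν := by
    intro γ' _ h1 h2 φ ψ
    rw [integral_add (int_of_cont γ' (by fun_prop)) (int_of_cont γ' (by fun_prop)),
      integral_fst γ' h1 φ φ.continuous, integral_snd γ' h2 ψ ψ.continuous]
  have inner_max : ∀ (γ' : Measure (Ω × Ω)) [IsProbabilityMeasure γ'], γ'.map Prod.fst = μ →
      γ'.map Prod.snd = ν → ∫ p, f₀ p ∂γ' ≤ ∫ p, f₀ p ∂γ := by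
    intro γ' _ h1 h2
    refine le_of_forall_pos_lt_add fun ε hε => ?_
    obtain ⟨φ, ψ, h, hlt⟩ := hdual ε hε
    refine lt_of_le_of_lt ?_ hlt
    rw [← integral_sum γ' h1 h2]
    exact integral_mono (int_of_cont γ' f₀.continuous) (int_of_cont γ' (by fun_prop))
      fun p => h p.1 p.2
  have cost_eq : ∀ (γ' : Measure (Ω × Ω)) [IsProbabilityMeasure γ'], γ'.map Prod.fst = μ →
      γ'.map Prod.snd = ν →
      ∫ p, ‖(p.1 : EuclideanSpace ℝ (Fin d)) - (p.2 : EuclideanSpace ℝ (Fin d))‖ ^ 2 ∂γ' =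
        ∫ x, ‖(x : EuclideanSpace ℝ (Fin d))‖ ^ 2 ∂μ +
        ∫ x, ‖(x : EuclideanSpace ℝ (Fin d))‖ ^ 2 ∂ν - 2 * ∫ p, f₀ p ∂γ' := by
    intro γ' _ h1 h2
    let q : C(Ω, ℝ) := ⟨fun x => ‖(x : EuclideanSpace ℝ (Fin d))‖ ^ 2, by fun_prop⟩
    have hq := integral_sum γ' h1 h2 q q
    simp only [q, ContinuousMap.coe_mk] at hq
    rw [← hq, ← integral_const_mul,
      ← integral_sub (int_of_cont γ' (by fun_prop)) (int_of_cont γ' (by fun_prop))]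
    refine integral_congr_ae (Eventually.of_forall fun p => ?_)
    simp only [f₀, ContinuousMap.coe_mk]
    rw [norm_sub_sq_real]
    ring
  have W2_eq : W2sq μ ν =
      ∫ p, ‖(p.1 : EuclideanSpace ℝ (Fin d)) - (p.2 : EuclideanSpace ℝ (Fin d))‖ ^ 2 ∂γ := by
    refine IsLeast.csInf_eq ⟨⟨γ, hγ, hfst, hsnd, rfl⟩, ?_⟩
    rintro c ⟨γ', hγ', h1, h2, rfl⟩
    rw [cost_eq γ hfst hsnd, cost_eq γ' h1 h2]
    linarith [inner_max γ' h1 h2]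
  choose φ ψ hle hlt using fun k : ℕ => hdual ((1 / 2 : ℝ) ^ k) (by positivity)
  have hgap := ae_tendsto_zero_of_integral_le (μ := γ)
    (g := fun k p => φ k p.1 + ψ k p.2 - f₀ p) (a := fun k => (1 / 2 : ℝ) ^ k)
    (fun k => int_of_cont γ (by fun_prop)) (fun k p => sub_nonneg.2 (hle k p.1 p.2))
    summable_geometric_two (fun k => by
      rw [integral_sub (int_of_cont γ (by fun_prop)) (int_of_cont γ (by fun_prop)),
        integral_sum γ hfst hsnd]
      linarith [hlt k])
  obtain ⟨C, u, hu, hsub⟩ := exists_lipschitzWith_subgradient_of_tendsto hΩ φ ψ hle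
  have hdiff : ∀ᵐ p ∂γ, DifferentiableAt ℝ u (p.1 : EuclideanSpace ℝ (Fin d)) := by
    have h1 := hμ.ae_le (hu.ae_differentiableAt (μ := volume))
    have h2 := ae_of_ae_map measurable_subtype_coe.aemeasurable h1
    rw [← hfst] at h2
    exact ae_of_ae_map measurable_fst.aemeasurable h2
  have hgrad : Measurable (gradient u) :=
    (InnerProductSpace.toDual ℝ (EuclideanSpace ℝ (Fin d))).symm.continuous.measurable.comp
      (measurable_fderiv ℝ u)
  classical
  let T : Ω → Ω := fun x => ⟨if gradient u x ∈ Ω then gradient u x else x₀, by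
    split_ifs with h
    exacts [h, x₀.2]⟩
  have hT : Measurable T := (Measurable.ite (hgrad.comp measurable_subtype_coe hΩ.measurableSet)
    (hgrad.comp measurable_subtype_coe) measurable_const).subtype_mk
  have hgraph : ∀ᵐ p ∂γ, p.2 = T p.1 := by
    filter_upwards [hgap, hdiff] with p hp hd
    have := eq_gradient_of_subgradient hd (hsub p.1 p.2 hp)
    have hmem : gradient u p.1 ∈ Ω := this ▸ p.2.2
    refine Subtype.ext ?_
    simp only [T, if_pos hmem]
    exact this
  refine ⟨T, hT, ?_, ?_⟩
  · rw [← hfst, Measure.map_map hT measurable_fst, ← hsnd]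
    exact Measure.map_congr (hgraph.mono fun p hp => hp.symm)
  · rw [W2_eq, ← hfst, integral_map measurable_fst.aemeasurable
      (Measurable.aestronglyMeasurable (by fun_prop))]
    refine integral_congr_ae (hgraph.mono fun p hp => ?_)
    simp only
    rw [hp, norm_sub_rev]

/-- If `ρ*` minimizes the measure-valued minimizing movement problem
`ρ ↦ ℒ(ρ) + (1/(2τ)) W₂²(ρ, ν)`, then there exists an optimal transport map from `ν` to `ρ*`,
and any such optimal map minimizes the map-valued problem
`T ↦ ℒ(T_♯ν) + (1/(2τ)) W₂²(T_♯ν, ν)` over Borel maps. -/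
theorem measure_minimizer_gives_map_minimizer
    {d : ℕ} (hd : 1 ≤ d) (Ω : Set (EuclideanSpace ℝ (Fin d)))
    (hΩcompact : IsCompact Ω) (hΩconvex : Convex ℝ Ω)
    (hΩboundary : volume (frontier Ω) = 0)
    (ν : ProbabilityMeasure Ω)
    (hνac : (ν : Measure Ω).map Subtype.val ≪ (volume : Measure (EuclideanSpace ℝ (Fin d))))
    (L : ProbabilityMeasure Ω → EReal)
    (hLlsc : LowerSemicontinuous L)
    (hLnotbot : ∀ ρ, L ρ ≠ ⊥)
    (hLproper : ∃ ρ, L ρ ≠ ⊤)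
    (τ : ℝ) (hτ : 0 < τ)
    (ρstar : ProbabilityMeasure Ω)
    (hmin : ∀ ρ : ProbabilityMeasure Ω,
      L ρstar + ((1 / (2 * τ) * W2sq (ρstar : Measure Ω) (ν : Measure Ω) : ℝ) : EReal)
        ≤ L ρ + ((1 / (2 * τ) * W2sq (ρ : Measure Ω) (ν : Measure Ω) : ℝ) : EReal)) :
    (∃ T : Ω → Ω, IsOptimalTransportMap T (ν : Measure Ω) (ρstar : Measure Ω)) ∧
    ∀ (T : Ω → Ω) (hT : Measurable T),
      IsOptimalTransportMap T (ν : Measure Ω) (ρstar : Measure Ω) →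
      ∀ (S : Ω → Ω) (hS : Measurable S),
        L (ν.map hT.aemeasurable) +
          ((1 / (2 * τ) * W2sq ((ν.map hT.aemeasurable : ProbabilityMeasure Ω) : Measure Ω)
            (ν : Measure Ω) : ℝ) : EReal)
        ≤ L (ν.map hS.aemeasurable) +
          ((1 / (2 * τ) * W2sq ((ν.map hS.aemeasurable : ProbabilityMeasure Ω) : Measure Ω)
            (ν : Measure Ω) : ℝ) : EReal) := by
  refine ⟨exists_isOptimalTransportMap hΩcompact _ _ hνac, fun T hT hopt S hS => ?_⟩
  have hTν : ν.map hT.aemeasurable = ρstar := Subtype.ext hopt.2.1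
  rw [hTν]
  exact hmin _
end

section
/- Let d ≥ 1, let Ω ⊂ ℝ^d be a compact convex set, let ρ be a Borel probability measure on Ω that is absolutely continuous with respect to Lebesgue measure, let ℱ be a compact topological space, and let ℒ : ℱ × P(Ω) → ℝ be jointly continuous and nonnegative. Suppose there exist a Borel measurable map T₀ : Ω → Ω and F₀ ∈ ℱ with ℒ(F₀, (T₀)_♯ρ) = 0. Then the constrained problem of minimizing ∫_Ω ‖T(x) − x‖² dρ(x) over all Borel measurable maps T : Ω → Ω and F ∈ ℱ subject to the constraint ℒ(F, T_♯ρ) = 0 admits a minimizer (T*, F*) such that T* is an optimal transport map from ρ to T*_♯ρ. -/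
open MeasureTheory Filter Topology Set

/-- A coupling minimizing the integral of a bounded cost `c` among all couplings with the same
marginals is almost surely `c`-monotone: swapping the targets of two independent samples never
decreases the total cost. -/
theorem ae_prod_cost_le_swap_of_minimal {X Y : Type*} [MeasurableSpace X] [MeasurableSpace Y]
    (γ : Measure (X × Y)) [IsProbabilityMeasure γ] {c : X × Y → ℝ} (hc : Measurable c) {M : ℝ}
    (hM : ∀ p, ‖c p‖ ≤ M)
    (hmin : ∀ γ' : Measure (X × Y), IsProbabilityMeasure γ' → γ'.map Prod.fst = γ.map Prod.fst →
      γ'.map Prod.snd = γ.map Prod.snd → ∫ p, c p ∂γ ≤ ∫ p, c p ∂γ') :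
    ∀ᵐ z ∂γ.prod γ, c z.1 + c z.2 ≤ c (z.1.1, z.2.2) + c (z.2.1, z.1.2) := by
  set A : Set ((X × Y) × (X × Y)) := {z | c (z.1.1, z.2.2) + c (z.2.1, z.1.2) < c z.1 + c z.2}
    with hA
  have hAm : MeasurableSet A := measurableSet_lt (by fun_prop) (by fun_prop)
  set η := (γ.prod γ).restrict A
  have hswap : η.map Prod.swap = η := by
    have hpre : Prod.swap ⁻¹' A = A := by
      ext z
      simp only [hA, mem_preimage, mem_ofPred_eq, Prod.fst_swap, Prod.snd_swap]
      rw [add_comm (c z.2), add_comm (c (z.2.1, z.1.2))]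
    have h := Measure.restrict_map (μ := γ.prod γ) measurable_swap hAm
    rw [hpre, Measure.prod_swap] at h
    exact h.symm
  set P := η.map Prod.fst with hP
  have hPle : P ≤ γ := by
    calc P ≤ (γ.prod γ).map Prod.fst := Measure.map_mono Measure.restrict_le_self measurable_fst
      _ = γ := by simp
  set S := η.map (fun z => (z.1.1, z.2.2)) with hS
  have hcancel : γ - P + P = γ := Measure.sub_add_cancel_of_le hPle
  have hSfst : S.map Prod.fst = P.map Prod.fst := by
    rw [hS, hP, Measure.map_map (by fun_prop) (by fun_prop),
      Measure.map_map (by fun_prop) (by fun_prop)]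
    rfl
  have hSsnd : S.map Prod.snd = P.map Prod.snd := by
    rw [hS, hP, Measure.map_map (by fun_prop) (by fun_prop),
      Measure.map_map (by fun_prop) (by fun_prop)]
    conv_rhs => rw [← hswap]
    rw [Measure.map_map (by fun_prop) (by fun_prop)]
    rfl
  have hfst : (γ - P + S).map Prod.fst = γ.map Prod.fst := by
    rw [Measure.map_add _ _ measurable_fst, hSfst, ← Measure.map_add _ _ measurable_fst, hcancel]
  have hsnd : (γ - P + S).map Prod.snd = γ.map Prod.snd := by
    rw [Measure.map_add _ _ measurable_snd, hSsnd, ← Measure.map_add _ _ measurable_snd, hcancel]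
  have hprob : IsProbabilityMeasure (γ - P + S) := by
    have h : IsProbabilityMeasure ((γ - P + S).map Prod.fst) := by
      rw [hfst]; exact Measure.isProbabilityMeasure_map (by fun_prop)
    exact Measure.isProbabilityMeasure_of_map (f := Prod.fst)
  have hint (μ : Measure (X × Y)) [IsFiniteMeasure μ] : Integrable c μ :=
    Integrable.of_bound hc.aestronglyMeasurable M (.of_forall hM)
  have hintη {f : (X × Y) × (X × Y) → X × Y} (hf : Measurable f) :
      Integrable (fun z => c (f z)) η :=
    Integrable.of_bound (hc.comp hf).aestronglyMeasurable M (.of_forall fun z => hM _)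
  have hPS : ∫ p, c p ∂P ≤ ∫ p, c p ∂S := by
    have h := hmin _ hprob hfst hsnd
    nth_rewrite 1 [← hcancel] at h
    rw [integral_add_measure (hint _) (hint _), integral_add_measure (hint _) (hint _)] at h
    linarith
  rw [hP, hS, integral_map (by fun_prop) hc.aestronglyMeasurable,
    integral_map (by fun_prop) hc.aestronglyMeasurable] at hPS
  have hsw {f : (X × Y) × (X × Y) → X × Y} (hf : Measurable f) :
      ∫ z, c (f z) ∂η = ∫ z, c (f z.swap) ∂η := by
    conv_lhs => rw [← hswap]
    exact integral_map (by fun_prop) (hc.comp hf).aestronglyMeasurable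
  have h1 : ∫ z, c z.1 ∂η = ∫ z, c z.2 ∂η := hsw measurable_fst
  have h2 : ∫ z, c (z.1.1, z.2.2) ∂η = ∫ z, c (z.2.1, z.1.2) ∂η :=
    hsw (f := fun z => (z.1.1, z.2.2)) (by fun_prop)
  have i1 := hintη measurable_fst
  have i2 := hintη measurable_snd
  have i3 := hintη (f := fun z => (z.1.1, z.2.2)) (by fun_prop)
  have i4 := hintη (f := fun z => (z.2.1, z.1.2)) (by fun_prop)
  have hD : ∫ z, ((c z.1 + c z.2) - (c (z.1.1, z.2.2) + c (z.2.1, z.1.2))) ∂η ≤ 0 := by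
    rw [integral_sub (by exact i1.add i2) (by exact i3.add i4), integral_add i1 i2,
      integral_add i3 i4]
    linarith
  have hpos : 0 ≤ᵐ[η] fun z => (c z.1 + c z.2) - (c (z.1.1, z.2.2) + c (z.2.1, z.1.2)) := by
    filter_upwards [ae_restrict_mem hAm] with z hz
    exact sub_nonneg.2 (le_of_lt hz)
  have hzero := (integral_eq_zero_iff_of_nonneg_ae hpos ((i1.add i2).sub (i3.add i4))).1
    (le_antisymm hD (integral_nonneg_of_ae hpos))
  have hnot := (ae_restrict_iff' hAm).1 hzero
  filter_upwards [hnot] with z hz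
  by_contra! hlt
  have : c z.1 + c z.2 - (c (z.1.1, z.2.2) + c (z.2.1, z.1.2)) = 0 := hz hlt
  linarith

/-- A continuous relation that holds for almost every pair of independent samples of `μ` holds for
every pair of points in the support of `μ`. -/
theorem le_of_ae_prod_le_of_mem_support {Z : Type*} [TopologicalSpace Z] [MeasurableSpace Z]
    (μ : Measure Z) [SFinite μ] {f g : Z × Z → ℝ} (hf : Continuous f) (hg : Continuous g)
    (h : ∀ᵐ z ∂μ.prod μ, f z ≤ g z) {p q : Z} (hp : p ∈ μ.support) (hq : q ∈ μ.support) :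
    f (p, q) ≤ g (p, q) := by
  by_contra! hlt
  have hU : {z | g z < f z} ∈ 𝓝 (p, q) := (isOpen_lt hg hf).mem_nhds hlt
  obtain ⟨U, hUp, V, hVq, hUV⟩ := mem_nhds_prod_iff.1 hU
  have hnull : (μ.prod μ) (U ×ˢ V) = 0 := by
    refine measure_mono_null (fun z hz => ?_) h
    exact not_le.2 (show g z < f z from hUV hz)
  rw [Measure.prod_prod, mul_eq_zero] at hnull
  rw [Measure.mem_support_iff_forall] at hp hq
  exact hnull.elim (hp U hUp).ne' (hq V hVq).ne'

/-- For a compact relation `C`, the set of points with two images whose `i`-th coordinates differ is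
measurable. -/
theorem measurableSet_coordinate_multivalued {d : ℕ}
    {C : Set (EuclideanSpace ℝ (Fin d) × EuclideanSpace ℝ (Fin d))} (hC : IsCompact C)
    (i : Fin d) :
    MeasurableSet {x | ∃ y y', (x, y) ∈ C ∧ (x, y') ∈ C ∧ y i < y' i} := by
  have heq : {x | ∃ y y', (x, y) ∈ C ∧ (x, y') ∈ C ∧ y i < y' i} =
      ⋃ n : ℕ, (fun z : EuclideanSpace ℝ (Fin d) × EuclideanSpace ℝ (Fin d) ×
        EuclideanSpace ℝ (Fin d) => z.1) ''
        {z | (z.1, z.2.1) ∈ C ∧ (z.1, z.2.2) ∈ C ∧ z.2.1 i + 1 / ((n : ℝ) + 1) ≤ z.2.2 i} := by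
    ext x
    simp only [mem_ofPred_eq, mem_iUnion, mem_image, Prod.exists, exists_and_right, exists_eq_right]
    constructor
    · rintro ⟨y, y', hy, hy', hlt⟩
      obtain ⟨n, hn⟩ := exists_nat_one_div_lt (sub_pos.2 hlt)
      exact ⟨n, y, y', hy, hy', by linarith⟩
    · rintro ⟨n, y, y', hy, hy', hle⟩
      have : 0 < 1 / ((n : ℝ) + 1) := by positivity
      exact ⟨y, y', hy, hy', by linarith⟩
  rw [heq]
  refine MeasurableSet.iUnion fun n => ?_
  refine (IsCompact.image ?_ continuous_fst).measurableSet
  refine IsCompact.of_isClosed_subset ((hC.image continuous_fst).prod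
    ((hC.image continuous_snd).prod (hC.image continuous_snd))) ?_ ?_
  · refine (hC.isClosed.preimage (f := fun z : EuclideanSpace ℝ (Fin d) ×
      EuclideanSpace ℝ (Fin d) × EuclideanSpace ℝ (Fin d) => (z.1, z.2.1)) (by fun_prop)).inter
      ((hC.isClosed.preimage (f := fun z : EuclideanSpace ℝ (Fin d) ×
      EuclideanSpace ℝ (Fin d) × EuclideanSpace ℝ (Fin d) => (z.1, z.2.2)) (by fun_prop)).inter ?_)
    exact isClosed_le (f := fun z : EuclideanSpace ℝ (Fin d) × EuclideanSpace ℝ (Fin d) ×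
      EuclideanSpace ℝ (Fin d) => z.2.1 i + 1 / ((n : ℝ) + 1)) (g := fun z => z.2.2 i)
      (by fun_prop) (by fun_prop)
  · rintro ⟨x, y, y'⟩ ⟨hy, hy', -⟩
    exact ⟨⟨_, hy, rfl⟩, ⟨_, hy, rfl⟩, ⟨_, hy', rfl⟩⟩

/-- Along every line parallel to the `i`-th axis, a monotone relation has only countably many points
with two images whose `i`-th coordinates differ. -/
theorem countable_coordinate_multivalued_line {d : ℕ}
    {C : Set (EuclideanSpace ℝ (Fin d) × EuclideanSpace ℝ (Fin d))}
    (hmono : ∀ p ∈ C, ∀ q ∈ C, 0 ≤ inner ℝ (p.1 - q.1) (p.2 - q.2)) (i : Fin d)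
    (a : EuclideanSpace ℝ (Fin d)) :
    {t : ℝ | ∃ y y', (a + t • EuclideanSpace.single i (1 : ℝ), y) ∈ C ∧
      (a + t • EuclideanSpace.single i (1 : ℝ), y') ∈ C ∧ y i < y' i}.Countable := by
  set s := {t : ℝ | ∃ y y', (a + t • EuclideanSpace.single i (1 : ℝ), y) ∈ C ∧
      (a + t • EuclideanSpace.single i (1 : ℝ), y') ∈ C ∧ y i < y' i}
  choose! y y' hy hy' hlt using fun t (ht : t ∈ s) => ht
  have hle {t u : ℝ} (ht : t ∈ s) (hu : u ∈ s) (htu : t < u) : y' t i ≤ y u i := by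
    have h := hmono _ (hy u hu) _ (hy' t ht)
    have heq : a + u • EuclideanSpace.single i (1 : ℝ) -
        (a + t • EuclideanSpace.single i (1 : ℝ)) = (u - t) • EuclideanSpace.single i (1 : ℝ) := by
      rw [sub_smul]; abel
    simp only [heq, inner_smul_left, EuclideanSpace.inner_single_left] at h
    simp only [conj_trivial, map_one, one_mul, PiLp.sub_apply] at h
    have := nonneg_of_mul_nonneg_right h (sub_pos.2 htu)
    linarith
  have hdisj : s.PairwiseDisjoint fun t => Ioo (y t i) (y' t i) := by
    intro t ht u hu htu
    refine Set.disjoint_left.2 fun r hr hr' => ?_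
    rcases lt_or_gt_of_ne htu with h | h
    · have := hle ht hu h
      linarith [hr.2, hr'.1]
    · have := hle hu ht h
      linarith [hr.1, hr'.2]
  exact hdisj.countable_of_isOpen (fun _ _ => isOpen_Ioo) fun t ht => nonempty_Ioo.2 (hlt t ht)

/-- A compact monotone relation on Euclidean space is single-valued Lebesgue almost everywhere. -/
theorem ae_singleValued_of_monotone {d : ℕ}
    {C : Set (EuclideanSpace ℝ (Fin d) × EuclideanSpace ℝ (Fin d))} (hC : IsCompact C)
    (hmono : ∀ p ∈ C, ∀ q ∈ C, 0 ≤ inner ℝ (p.1 - q.1) (p.2 - q.2)) :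
    ∀ᵐ x, x ∉ ⋃ i : Fin d, {x | ∃ y y', (x, y) ∈ C ∧ (x, y') ∈ C ∧ y i < y' i} := by
  have h (i : Fin d) : ∀ᵐ x : EuclideanSpace ℝ (Fin d),
      x ∈ {x | ∃ y y', (x, y) ∈ C ∧ (x, y') ∈ C ∧ y i < y' i}ᶜ := by
    refine ae_mem_of_ae_add_linearMap_mem
      (LinearMap.toSpanSingleton ℝ _ (EuclideanSpace.single i (1 : ℝ))) volume volume
      (measurableSet_coordinate_multivalued hC i).compl fun a => ?_
    have := (countable_coordinate_multivalued_line hmono i a).ae_notMem volume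
    filter_upwards [this] with t ht
    simpa using ht
  filter_upwards [ae_all_iff.2 h] with x hx
  simpa using hx

/-- A measurable selection: a measure on `X × X` carried by a compact relation `C` that is
single-valued off a measurable set `B`, negligible for the first marginal, is induced by a
measurable map. -/
theorem exists_measurable_map_eq_of_singleValued {X : Type*} [TopologicalSpace X] [T2Space X]
    [CompactSpace X] [MeasurableSpace X] [BorelSpace X] (γ : Measure (X × X)) {C : Set (X × X)}
    (hC : IsClosed C) (hγC : ∀ᵐ p ∂γ, p ∈ C) {B : Set X} (hB : MeasurableSet B)
    (hγB : ∀ᵐ x ∂γ.map Prod.fst, x ∉ B)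
    (hsingle : ∀ x ∉ B, ∀ y y', (x, y) ∈ C → (x, y') ∈ C → y = y') :
    ∃ T : X → X, Measurable T ∧ γ = (γ.map Prod.fst).map fun x => (x, T x) := by
  classical
  let T : X → X := fun x => if h : x ∉ B ∧ ∃ y, (x, y) ∈ C then h.2.choose else x
  have hT {x y : X} (hx : x ∉ B) (hy : (x, y) ∈ C) : T x = y := by
    have h : x ∉ B ∧ ∃ y, (x, y) ∈ C := ⟨hx, y, hy⟩
    simp only [T, dif_pos h]
    exact hsingle x hx _ _ h.2.choose_spec hy
  have hproj {K : Set (X × X)} (hK : IsClosed K) : MeasurableSet (Prod.fst '' K) :=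
    (hK.isCompact.image continuous_fst).measurableSet
  have hTm : Measurable T := by
    refine measurable_of_isClosed fun F hF => ?_
    have heq : T ⁻¹' F = (Prod.fst '' (C ∩ Prod.snd ⁻¹' F) ∩ Bᶜ) ∪
        (F ∩ (Prod.fst '' C ∩ Bᶜ)ᶜ) := by
      ext x
      by_cases h : x ∉ B ∧ ∃ y, (x, y) ∈ C
      · obtain ⟨hx, y, hy⟩ := h
        have hTx := hT hx hy
        simp only [mem_preimage, hTx, mem_union, mem_inter_iff, mem_image, Prod.exists,
          exists_and_right, exists_eq_right, mem_compl_iff]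
        constructor
        · exact fun hyF => Or.inl ⟨⟨y, hy, hyF⟩, hx⟩
        · rintro (⟨⟨y', hy', hF'⟩, -⟩ | ⟨-, hn⟩)
          · rwa [hsingle x hx _ _ hy hy']
          · exact absurd ⟨⟨y, hy⟩, hx⟩ hn
      · have hTx : T x = x := dif_neg h
        simp only [mem_preimage, hTx, mem_union, mem_inter_iff, mem_image, Prod.exists,
          exists_and_right, exists_eq_right, mem_compl_iff]
        constructor
        · exact fun hxF => Or.inr ⟨hxF, fun hn => h ⟨hn.2, hn.1⟩⟩
        · rintro (⟨⟨y', hy', -⟩, hx⟩ | ⟨hxF, -⟩)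
          · exact absurd ⟨hx, y', hy'⟩ h
          · exact hxF
    rw [heq]
    exact ((hproj (hC.inter (hF.preimage continuous_snd))).inter hB.compl).union
      (hF.measurableSet.inter ((hproj hC).inter hB.compl).compl)
  refine ⟨T, hTm, ?_⟩
  rw [Measure.map_map (by fun_prop) (by fun_prop)]
  conv_lhs => rw [← Measure.map_id (μ := γ)]
  refine Measure.map_congr ?_
  filter_upwards [hγC, ae_of_ae_map (by fun_prop) hγB] with p hpC hpB
  exact Prod.ext rfl (hT hpB hpC).symm

/-- Existence part of Brenier's theorem on a compact set: a coupling that minimizes the quadratic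
cost among couplings with the same marginals, and whose first marginal is absolutely continuous, is
induced by a measurable map. -/
theorem exists_measurable_map_of_minimal_coupling {d : ℕ} {Ω : Set (EuclideanSpace ℝ (Fin d))}
    (hΩ : IsCompact Ω) (γ : Measure (Ω × Ω)) [IsProbabilityMeasure γ]
    (hac : (γ.map Prod.fst).map Subtype.val ≪ (volume : Measure (EuclideanSpace ℝ (Fin d))))
    (hmin : ∀ γ' : Measure (Ω × Ω), IsProbabilityMeasure γ' → γ'.map Prod.fst = γ.map Prod.fst →
      γ'.map Prod.snd = γ.map Prod.snd →
      ∫ p, ‖(p.1 : EuclideanSpace ℝ (Fin d)) - p.2‖ ^ 2 ∂γ ≤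
        ∫ p, ‖(p.1 : EuclideanSpace ℝ (Fin d)) - p.2‖ ^ 2 ∂γ') :
    ∃ T : Ω → Ω, Measurable T ∧ γ = (γ.map Prod.fst).map fun x => (x, T x) := by
  have : CompactSpace Ω := isCompact_iff_compactSpace.1 hΩ
  let c : Ω × Ω → ℝ := fun p => ‖(p.1 : EuclideanSpace ℝ (Fin d)) - p.2‖ ^ 2
  have hc : Continuous c := by fun_prop
  obtain ⟨M, hM⟩ := isCompact_univ.exists_bound_of_continuousOn hc.continuousOn
  have hae := ae_prod_cost_le_swap_of_minimal γ hc.measurable (fun p => hM p (mem_univ p)) hmin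
  let ι : Ω × Ω → EuclideanSpace ℝ (Fin d) × EuclideanSpace ℝ (Fin d) := fun p => (p.1, p.2)
  have hC : IsCompact (ι '' γ.support) :=
    (Measure.isClosed_support (μ := γ)).isCompact.image (by fun_prop)
  have hmono : ∀ p ∈ ι '' γ.support, ∀ q ∈ ι '' γ.support,
      0 ≤ inner ℝ (p.1 - q.1) (p.2 - q.2) := by
    rintro _ ⟨p, hp, rfl⟩ _ ⟨q, hq, rfl⟩
    have h := le_of_ae_prod_le_of_mem_support γ (f := fun z => c z.1 + c z.2)
      (g := fun z => c (z.1.1, z.2.2) + c (z.2.1, z.1.2)) (by fun_prop) (by fun_prop) hae hp hq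
    simp only [c, norm_sub_sq_real] at h
    simp only [ι, inner_sub_left, inner_sub_right]
    linarith
  have hmem {x y : Ω} : ((x : EuclideanSpace ℝ (Fin d)), (y : EuclideanSpace ℝ (Fin d))) ∈
      ι '' γ.support ↔ (x, y) ∈ γ.support := by
    constructor
    · rintro ⟨p, hp, hpxy⟩
      have : p = (x, y) := Prod.ext (Subtype.ext (congrArg Prod.fst hpxy))
        (Subtype.ext (congrArg Prod.snd hpxy))
      rwa [← this]
    · exact fun h => ⟨_, h, rfl⟩
  refine exists_measurable_map_eq_of_singleValued γ Measure.isClosed_support Measure.support_mem_ae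
    (measurable_subtype_coe (MeasurableSet.iUnion fun i =>
      measurableSet_coordinate_multivalued hC i))
    (ae_of_ae_map measurable_subtype_coe.aemeasurable
      (hac.ae_le (ae_singleValued_of_monotone hC hmono))) ?_
  intro x hx y y' hy hy'
  simp only [mem_preimage, mem_iUnion, mem_ofPred_eq, not_exists, not_and, not_lt] at hx
  refine Subtype.ext (PiLp.ext fun i => le_antisymm ?_ ?_)
  · exact hx i _ _ (hmem.2 hy') (hmem.2 hy)
  · exact hx i _ _ (hmem.2 hy) (hmem.2 hy')

/-- Minimizing the transport cost `∫ ‖T(x) - x‖² dρ` under the constraint of zero loss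
`ℒ(F, T_♯ρ) = 0` admits a minimizer `(T*, F*)` whose map part `T*` is an optimal transport
map from `ρ` to `T*_♯ρ`, provided the constraint set is nonempty. -/
theorem constrained_zero_loss_problem_has_OT_minimizer
    {d : ℕ} (hd : 1 ≤ d) (Ω : Set (EuclideanSpace ℝ (Fin d)))
    (hΩcompact : IsCompact Ω) (hΩconvex : Convex ℝ Ω)
    (ρ : ProbabilityMeasure Ω)
    (hρac : (ρ : Measure Ω).map Subtype.val ≪ (volume : Measure (EuclideanSpace ℝ (Fin d))))
    (𝓕 : Type*) [TopologicalSpace 𝓕] [CompactSpace 𝓕]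
    (L : 𝓕 → ProbabilityMeasure Ω → ℝ)
    (hLcont : Continuous fun p : 𝓕 × ProbabilityMeasure Ω => L p.1 p.2)
    (hLnonneg : ∀ F μ, 0 ≤ L F μ)
    (T₀ : Ω → Ω) (hT₀ : Measurable T₀) (F₀ : 𝓕)
    (hfeasible : L F₀ (ρ.map hT₀.aemeasurable) = 0) :
    ∃ (Tstar : Ω → Ω) (hTstar : Measurable Tstar) (Fstar : 𝓕),
      L Fstar (ρ.map hTstar.aemeasurable) = 0 ∧
      (∀ (T : Ω → Ω) (hT : Measurable T) (F : 𝓕),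
        L F (ρ.map hT.aemeasurable) = 0 →
        (∫ x, ‖(Tstar x : EuclideanSpace ℝ (Fin d)) -
          (x : EuclideanSpace ℝ (Fin d))‖ ^ 2 ∂(ρ : Measure Ω))
        ≤ ∫ x, ‖(T x : EuclideanSpace ℝ (Fin d)) -
          (x : EuclideanSpace ℝ (Fin d))‖ ^ 2 ∂(ρ : Measure Ω)) ∧
      IsOptimalTransportMap Tstar (ρ : Measure Ω) ((ρ : Measure Ω).map Tstar) := by
  have : CompactSpace Ω := isCompact_iff_compactSpace.1 hΩcompact
  let c : Ω × Ω → ℝ := fun p =>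
    ‖(p.1 : EuclideanSpace ℝ (Fin d)) - (p.2 : EuclideanSpace ℝ (Fin d))‖ ^ 2
  have hc : Continuous c := by fun_prop
  have hgraph {T : Ω → Ω} (hT : Measurable T) : Measurable fun x => (x, T x) :=
    measurable_id.prodMk hT
  have hfstgraph {T : Ω → Ω} (hT : Measurable T) :
      ((ρ : Measure Ω).map fun x => (x, T x)).map Prod.fst = ρ := by
    rw [Measure.map_map measurable_fst (hgraph hT)]
    exact Measure.map_id
  have hsndgraph {T : Ω → Ω} (hT : Measurable T) :
      ((ρ : Measure Ω).map fun x => (x, T x)).map Prod.snd = (ρ : Measure Ω).map T := by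
    rw [Measure.map_map measurable_snd (hgraph hT)]
    rfl
  have hcostgraph {T : Ω → Ω} (hT : Measurable T) :
      ∫ p, c p ∂((ρ : Measure Ω).map fun x => (x, T x)) =
        ∫ x, ‖(T x : EuclideanSpace ℝ (Fin d)) - (x : EuclideanSpace ℝ (Fin d))‖ ^ 2
          ∂(ρ : Measure Ω) := by
    rw [integral_map (hgraph hT).aemeasurable hc.measurable.aestronglyMeasurable]
    simp only [c, norm_sub_rev]
  let S : Set (𝓕 × ProbabilityMeasure (Ω × Ω)) :=
    {p | p.2.map measurable_fst.aemeasurable = ρ ∧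
      L p.1 (p.2.map measurable_snd.aemeasurable) = 0}
  have hSclosed : IsClosed S := by
    have hfst := (ProbabilityMeasure.continuous_map (Ω := Ω × Ω) (Ω' := Ω) continuous_fst)
    have hsnd := (ProbabilityMeasure.continuous_map (Ω := Ω × Ω) (Ω' := Ω) continuous_snd)
    exact (isClosed_eq (hfst.comp continuous_snd) continuous_const).inter
      (isClosed_eq (hLcont.comp (continuous_fst.prodMk (hsnd.comp continuous_snd)))
        continuous_const)
  have hmemS {T : Ω → Ω} (hT : Measurable T) {F : 𝓕} (hF : L F (ρ.map hT.aemeasurable) = 0) :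
      (F, ρ.map (hgraph hT).aemeasurable) ∈ S := by
    refine ⟨Subtype.ext (hfstgraph hT), ?_⟩
    rw [← hF]
    exact congrArg (L F) (Subtype.ext (hsndgraph hT))
  have hcost : Continuous fun p : 𝓕 × ProbabilityMeasure (Ω × Ω) =>
      ∫ z, c z ∂(p.2 : Measure (Ω × Ω)) :=
    (ProbabilityMeasure.continuous_integral_continuousMap (⟨c, hc⟩ : C(Ω × Ω, ℝ))).comp
      continuous_snd
  obtain ⟨⟨F, γ⟩, ⟨hγfst, hγL⟩, hγmin⟩ :=
    hSclosed.isCompact.exists_isMinOn ⟨_, hmemS hT₀ hfeasible⟩ hcost.continuousOn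
  have hγfst' : (γ : Measure (Ω × Ω)).map Prod.fst = ρ := congrArg Subtype.val hγfst
  have hγopt : ∀ γ' : Measure (Ω × Ω), IsProbabilityMeasure γ' →
      γ'.map Prod.fst = (γ : Measure (Ω × Ω)).map Prod.fst →
      γ'.map Prod.snd = (γ : Measure (Ω × Ω)).map Prod.snd →
      ∫ p, c p ∂(γ : Measure (Ω × Ω)) ≤ ∫ p, c p ∂γ' := by
    intro γ' hγ' h1 h2
    refine hγmin (show (F, (⟨γ', hγ'⟩ : ProbabilityMeasure (Ω × Ω))) ∈ S from ⟨?_, ?_⟩)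
    · exact Subtype.ext (h1.trans hγfst')
    · rw [← hγL]
      exact congrArg (L F) (Subtype.ext h2)
  obtain ⟨T, hT, hγT⟩ := exists_measurable_map_of_minimal_coupling hΩcompact
    (γ : Measure (Ω × Ω)) (by rwa [hγfst']) hγopt
  rw [hγfst'] at hγT
  have hγsnd : (γ : Measure (Ω × Ω)).map Prod.snd = (ρ : Measure Ω).map T := by
    rw [hγT, hsndgraph hT]
  have hγcost := hcostgraph hT
  rw [← hγT] at hγcost
  refine ⟨T, hT, F, ?_, fun T' hT' F' hF' => ?_, hT, rfl, ?_⟩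
  · rw [← hγL]
    exact congrArg (L F) (Subtype.ext hγsnd.symm)
  · rw [← hγcost, ← hcostgraph hT']
    exact hγmin (hmemS hT' hF')
  · rw [← hγcost]
    refine Eq.symm (IsLeast.csInf_eq ?_)
    refine ⟨⟨γ, inferInstance, hγfst', hγsnd, rfl⟩, ?_⟩
    rintro _ ⟨γ', hγ', h1, h2, rfl⟩
    exact hγopt γ' hγ' (h1.trans hγfst'.symm) (h2.trans hγsnd.symm)
end
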